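/- arXiv:2404.00637 — 4 statements merged into one kernel-verified Lean document; each statement's English description precedes it below -/
import Mathlib

section
/- For positive semidefinite matrices A, B and parameters r ≥ 1, q ≥ 0, one has Tr[(A^r B^r A^r)^q] ≥ Tr[(A B A)^{rq}]. -/
open Matrix ComplexOrder Kronecker

/-- Real power of a matrix via functional calculus (eigendecomposition) on
Hermitian matrices; junk value `0` otherwise. -/
noncomputable def mrpow {n : Type*} [Fintype n] [DecidableEq n]
    (A : Matrix n n ℂ) (r : ℝ) : Matrix n n ℂ :=
  if h : A.IsHermitian then
    (h.eigenvectorUnitary : Matrix n n ℂ) *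
      Matrix.diagonal ((fun i => (((h.eigenvalues i : ℝ) ^ r : ℝ) : ℂ)) : n → ℂ) *
      star (h.eigenvectorUnitary : Matrix n n ℂ)
  else 0

/-- Entrywise complex conjugate of a matrix. -/
def conjM {n : Type*} [Fintype n] [DecidableEq n] (A : Matrix n n ℂ) : Matrix n n ℂ :=
  A.map (starRingEnd ℂ)

/-- The quantity `f_{α,z}(ρ,σ) = Tr[(σ^{(1-α)/(2z)} ρ^{α/z} σ^{(1-α)/(2z)})^z]`. -/
noncomputable def fRenyi {n : Type*} [Fintype n] [DecidableEq n]
    (α z : ℝ) (ρ σ : Matrix n n ℂ) : ℂ :=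
  (mrpow (mrpow σ ((1 - α) / (2 * z)) * mrpow ρ (α / z) * mrpow σ ((1 - α) / (2 * z))) z).trace

/-- The weighted matrix geometric mean `A ♯_λ B = A^{1/2} (A^{-1/2} B A^{-1/2})^λ A^{1/2}`. -/
noncomputable def geomMean {n : Type*} [Fintype n] [DecidableEq n]
    (A B : Matrix n n ℂ) (l : ℝ) : Matrix n n ℂ :=
  mrpow A (1/2) * mrpow (mrpow A (-(1/2)) * B * mrpow A (-(1/2))) l * mrpow A (1/2)

lemma Matrix.PosSemidef.mul_mul_self {m : Type*} [Fintype m] {X Y : Matrix m m ℂ}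
    (hX : X.PosSemidef) (hY : Y.PosSemidef) : (X * Y * X).PosSemidef := by
  simpa [hX.1.eq] using hY.mul_mul_conjTranspose_same X

section SpectralForm

variable {m : Type*} [Fintype m] [DecidableEq m]

/-- The matrix `U D Uᴴ`, where `D` is the real diagonal matrix with entries `d`. -/
noncomputable def spectralForm (U : Matrix m m ℂ) (d : m → ℝ) : Matrix m m ℂ :=
  U * diagonal (fun i => (d i : ℂ)) * Uᴴ

lemma isHermitian_spectralForm (U : Matrix m m ℂ) (d : m → ℝ) :
    (spectralForm U d).IsHermitian := by
  refine isHermitian_mul_mul_conjTranspose U (isHermitian_diagonal_iff.2 fun i => ?_)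
  simp [IsSelfAdjoint]

lemma posSemidef_spectralForm (U : Matrix m m ℂ) {d : m → ℝ} (hd : ∀ i, 0 ≤ d i) :
    (spectralForm U d).PosSemidef :=
  (PosSemidef.diagonal fun i => by simpa using hd i).mul_mul_conjTranspose_same U

lemma spectralForm_mul {U : Matrix m m ℂ} (hU : U ∈ unitaryGroup m ℂ) (d e : m → ℝ) :
    spectralForm U d * spectralForm U e = spectralForm U (fun i => d i * e i) := by
  have h : Uᴴ * U = 1 := mem_unitaryGroup_iff'.1 hU
  calc spectralForm U d * spectralForm U e
      = U * diagonal (fun i => (d i : ℂ)) * (Uᴴ * U) * diagonal (fun i => (e i : ℂ)) * Uᴴ := by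
        simp only [spectralForm, Matrix.mul_assoc]
    _ = _ := by
        rw [h, Matrix.mul_one, Matrix.mul_assoc U, diagonal_mul_diagonal]
        simp [spectralForm]

lemma spectralForm_const {U : Matrix m m ℂ} (hU : U ∈ unitaryGroup m ℂ) (c : ℝ) :
    spectralForm U (fun _ => c) = algebraMap ℝ (Matrix m m ℂ) c := by
  have h : U * Uᴴ = 1 := mem_unitaryGroup_iff.1 hU
  have hc : (diagonal fun _ : m => (c : ℂ)) = (c : ℂ) • (1 : Matrix m m ℂ) := by
    rw [smul_one_eq_diagonal]
  rw [spectralForm, hc, Matrix.mul_smul, Matrix.smul_mul, Matrix.mul_one, h,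
    Algebra.algebraMap_eq_smul_one]
  ext i j
  simp

lemma trace_spectralForm {U : Matrix m m ℂ} (hU : U ∈ unitaryGroup m ℂ) (d : m → ℝ) :
    (spectralForm U d).trace = ((∑ i, d i : ℝ) : ℂ) := by
  have h : Uᴴ * U = 1 := mem_unitaryGroup_iff'.1 hU
  rw [spectralForm, trace_mul_comm, ← Matrix.mul_assoc, h, Matrix.one_mul, trace_diagonal]
  simp

/-- The functional calculus does not depend on the chosen diagonalization. -/
lemma spectralForm_comp_eq {U V : Matrix m m ℂ} (hU : U ∈ unitaryGroup m ℂ)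
    (hV : V ∈ unitaryGroup m ℂ) {d e : m → ℝ} (h : spectralForm U d = spectralForm V e)
    (f : ℝ → ℝ) : spectralForm U (fun i => f (d i)) = spectralForm V (fun i => f (e i)) := by
  have hU1 : Uᴴ * U = 1 := mem_unitaryGroup_iff'.1 hU
  have hU2 : U * Uᴴ = 1 := mem_unitaryGroup_iff.1 hU
  have hV1 : Vᴴ * V = 1 := mem_unitaryGroup_iff'.1 hV
  have hV2 : V * Vᴴ = 1 := mem_unitaryGroup_iff.1 hV
  have hW : (Vᴴ * U) * diagonal (fun i => (d i : ℂ)) =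
      diagonal (fun i => (e i : ℂ)) * (Vᴴ * U) := by
    calc (Vᴴ * U) * diagonal (fun i => (d i : ℂ)) = Vᴴ * spectralForm U d * U := by
          simp only [spectralForm, Matrix.mul_assoc, hU1, Matrix.mul_one]
      _ = (Vᴴ * V) * diagonal (fun i => (e i : ℂ)) * (Vᴴ * U) := by
          rw [h]; simp only [spectralForm, Matrix.mul_assoc]
      _ = _ := by rw [hV1, Matrix.one_mul]
  have hW' : (Vᴴ * U) * diagonal (fun i => (f (d i) : ℂ)) =
      diagonal (fun i => (f (e i) : ℂ)) * (Vᴴ * U) := by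
    ext i j
    have hij := congrFun (congrFun hW i) j
    rw [mul_diagonal, diagonal_mul] at hij ⊢
    by_cases hz : (Vᴴ * U) i j = 0
    · simp [hz]
    · rw [mul_comm] at hij
      have hde : d j = e i := by exact_mod_cast mul_right_cancel₀ hz hij
      rw [hde, mul_comm]
  calc spectralForm U (fun i => f (d i))
      = (V * Vᴴ) * U * diagonal (fun i => (f (d i) : ℂ)) * Uᴴ := by
        rw [hV2, Matrix.one_mul]; rfl
    _ = V * ((Vᴴ * U) * diagonal (fun i => (f (d i) : ℂ))) * Uᴴ := by
        simp only [Matrix.mul_assoc]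
    _ = V * diagonal (fun i => (f (e i) : ℂ)) * Vᴴ * (U * Uᴴ) := by
        rw [hW']; simp only [Matrix.mul_assoc]
    _ = _ := by rw [hU2, Matrix.mul_one]; rfl

lemma Matrix.IsHermitian.eq_spectralForm {P : Matrix m m ℂ} (hP : P.IsHermitian) :
    P = spectralForm (hP.eigenvectorUnitary : Matrix m m ℂ) hP.eigenvalues := by
  conv_lhs => rw [hP.spectral_theorem]
  rfl

lemma Matrix.PosSemidef.exists_eq_spectralForm {P : Matrix m m ℂ} (hP : P.PosSemidef) :
    ∃ U ∈ unitaryGroup m ℂ, ∃ d : m → ℝ, (∀ i, 0 ≤ d i) ∧ P = spectralForm U d :=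
  ⟨_, hP.1.eigenvectorUnitary.2, _, hP.eigenvalues_nonneg, hP.1.eq_spectralForm⟩

lemma mrpow_spectralForm {U : Matrix m m ℂ} (hU : U ∈ unitaryGroup m ℂ) (d : m → ℝ) (r : ℝ) :
    mrpow (spectralForm U d) r = spectralForm U (fun i => d i ^ r) := by
  have hP := isHermitian_spectralForm U d
  rw [mrpow, dif_pos hP]
  exact spectralForm_comp_eq hP.eigenvectorUnitary.2 hU hP.eq_spectralForm.symm (· ^ r)

lemma Matrix.PosSemidef.mrpow {P : Matrix m m ℂ} (hP : P.PosSemidef) (r : ℝ) :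
    (mrpow P r).PosSemidef := by
  obtain ⟨U, hU, d, hd, rfl⟩ := hP.exists_eq_spectralForm
  rw [mrpow_spectralForm hU]
  exact posSemidef_spectralForm U fun i => Real.rpow_nonneg (hd i) r

lemma mrpow_mrpow_inv {P : Matrix m m ℂ} (hP : P.PosSemidef) {r : ℝ} (hr : r ≠ 0) :
    mrpow (mrpow P r) r⁻¹ = P := by
  obtain ⟨U, hU, d, hd, rfl⟩ := hP.exists_eq_spectralForm
  rw [mrpow_spectralForm hU, mrpow_spectralForm hU]
  simp only [fun i => Real.rpow_rpow_inv (hd i) hr]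

open scoped MatrixOrder Matrix.Norms.L2Operator

lemma norm_spectralForm {U : Matrix m m ℂ} (hU : U ∈ unitaryGroup m ℂ) (d : m → ℝ) :
    ‖spectralForm U d‖ = ‖d‖ := by
  have h1 := CStarRing.norm_coe_unitary_mul (⟨U, hU⟩ : unitary (Matrix m m ℂ))
    (diagonal (fun i => (d i : ℂ)))
  have h2 := CStarRing.norm_mul_coe_unitary (U * diagonal (fun i => (d i : ℂ)))
    (star (⟨U, hU⟩ : unitary (Matrix m m ℂ)))
  rw [spectralForm]
  refine h2.trans (h1.trans ?_)
  rw [l2_opNorm_diagonal]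
  simp [Pi.norm_def, Complex.nnnorm_real]

/-- **Löwner–Heinz inequality** for matrix powers. -/
lemma mrpow_le_mrpow {P Q : Matrix m m ℂ} (hP : P.PosSemidef) (hPQ : P ≤ Q) {θ : ℝ}
    (hθ : θ ∈ Set.Icc (0 : ℝ) 1) : mrpow P θ ≤ mrpow Q θ := by
  have key : ∀ R : Matrix m m ℂ, R.PosSemidef → mrpow R θ = R ^ θ := fun R hR => by
    rw [CFC.rpow_eq_cfc_real (nonneg_iff_posSemidef.2 hR), hR.1.cfc_eq, mrpow, dif_pos hR.1]
    rfl
  have hQ : Q.PosSemidef := nonneg_iff_posSemidef.1 ((nonneg_iff_posSemidef.2 hP).trans hPQ)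
  rw [key P hP, key Q hQ]
  exact CFC.rpow_le_rpow hθ hPQ

lemma norm_mrpow_mul_le_of_pos {U Y : Matrix m m ℂ} (hU : U ∈ unitaryGroup m ℂ) {d : m → ℝ}
    (hd : ∀ i, 0 < d i) (hY : Y.PosSemidef) {θ : ℝ} (hθ : θ ∈ Set.Icc (0 : ℝ) 1) :
    ‖spectralForm U (fun i => d i ^ θ) * mrpow Y θ * spectralForm U (fun i => d i ^ θ)‖ ≤
      ‖spectralForm U d * Y * spectralForm U d‖ ^ θ := by
  set c := ‖spectralForm U d * Y * spectralForm U d‖ with hc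
  have hc0 : 0 ≤ c := norm_nonneg _
  have hd0 : ∀ i, 0 ≤ d i := fun i => (hd i).le
  have hsa : ∀ e : m → ℝ, IsSelfAdjoint (spectralForm U e) := isHermitian_spectralForm U
  have hXYX : spectralForm U d * Y * spectralForm U d ≤ algebraMap ℝ _ c :=
    (CStarAlgebra.norm_le_iff_le_algebraMap _ hc0 (nonneg_iff_posSemidef.2
      ((posSemidef_spectralForm U hd0).mul_mul_self hY))).1 le_rfl
  have hYle : Y ≤ spectralForm U (fun i => (d i)⁻¹ * c * (d i)⁻¹) := by
    have h := (hsa fun i => (d i)⁻¹).conjugate_le_conjugate hXYX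
    have e1 : spectralForm U (fun i => (d i)⁻¹) * spectralForm U d = 1 := by
      rw [spectralForm_mul hU]
      simp only [fun i => inv_mul_cancel₀ (hd i).ne', spectralForm_const hU, map_one]
    have e2 : spectralForm U d * spectralForm U (fun i => (d i)⁻¹) = 1 := by
      rw [spectralForm_mul hU]
      simp only [fun i => mul_inv_cancel₀ (hd i).ne', spectralForm_const hU, map_one]
    rw [← spectralForm_const hU c, spectralForm_mul hU, spectralForm_mul hU] at h
    refine le_trans (le_of_eq ?_) h
    calc Y = (spectralForm U (fun i => (d i)⁻¹) * spectralForm U d) * Y *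
          (spectralForm U d * spectralForm U (fun i => (d i)⁻¹)) := by rw [e1, e2]; simp
      _ = _ := by simp only [Matrix.mul_assoc]
  have hpow := mrpow_le_mrpow hY hYle hθ
  rw [mrpow_spectralForm hU] at hpow
  have h := (hsa fun i => d i ^ θ).conjugate_le_conjugate hpow
  rw [spectralForm_mul hU, spectralForm_mul hU] at h
  have e : ∀ i, d i ^ θ * ((d i)⁻¹ * c * (d i)⁻¹) ^ θ * d i ^ θ = c ^ θ := fun i => by
    have hi := inv_nonneg.2 (hd0 i)
    rw [← Real.mul_rpow (hd0 i) (by positivity), ← Real.mul_rpow (by have := hd0 i; positivity)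
      (hd0 i)]
    congr 1
    have := (hd i).ne'
    field_simp
  simp only [e, spectralForm_const hU] at h
  exact (CStarAlgebra.norm_le_iff_le_algebraMap _ (Real.rpow_nonneg hc0 θ)
    (nonneg_iff_posSemidef.2 ((posSemidef_spectralForm U fun i =>
      Real.rpow_nonneg (hd0 i) θ).mul_mul_self (hY.mrpow θ)))).2 h

lemma continuous_spectralForm (U : Matrix m m ℂ) : Continuous (spectralForm U) := by
  unfold spectralForm
  fun_prop

/-- **Cordes inequality**. -/
lemma norm_mrpow_mul_mrpow_mul_mrpow_le {X Y : Matrix m m ℂ} (hX : X.PosSemidef)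
    (hY : Y.PosSemidef) {θ : ℝ} (hθ : θ ∈ Set.Icc (0 : ℝ) 1) :
    ‖mrpow X θ * mrpow Y θ * mrpow X θ‖ ≤ ‖X * Y * X‖ ^ θ := by
  obtain ⟨U, hU, d, hd, rfl⟩ := hX.exists_eq_spectralForm
  rw [mrpow_spectralForm hU]
  have hd' : Continuous fun (ε : ℝ) i => d i + ε := by fun_prop
  have hdθ : Continuous fun (ε : ℝ) i => (d i + ε) ^ θ :=
    continuous_pi fun i => (by fun_prop : Continuous fun ε : ℝ => d i + ε).rpow_const
      fun _ => Or.inr hθ.1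
  have h1 : Continuous fun ε : ℝ => ‖spectralForm U (fun i => (d i + ε) ^ θ) * mrpow Y θ *
      spectralForm U (fun i => (d i + ε) ^ θ)‖ := by
    have := (continuous_spectralForm U).comp hdθ
    exact ((this.mul continuous_const).mul this).norm
  have h2 : Continuous fun ε : ℝ => ‖spectralForm U (fun i => d i + ε) * Y *
      spectralForm U (fun i => d i + ε)‖ ^ θ := by
    have := (continuous_spectralForm U).comp hd'
    exact ((this.mul continuous_const).mul this).norm.rpow_const fun _ => Or.inr hθ.1
  have l1 := (h1.tendsto 0).mono_left (nhdsWithin_le_nhds (s := Set.Ioi 0))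
  have l2 := (h2.tendsto 0).mono_left (nhdsWithin_le_nhds (s := Set.Ioi 0))
  simp only [add_zero] at l1 l2
  refine le_of_tendsto_of_tendsto l1 l2 ?_
  filter_upwards [self_mem_nhdsWithin] with ε hε
  exact norm_mrpow_mul_le_of_pos hU (fun i => add_pos_of_nonneg_of_pos (hd i) hε) hY hθ

end SpectralForm

section Compound

open Set.powersetCard

variable {m : Type*} [Fintype m] [DecidableEq m] [LinearOrder m]

/-- The `k`-th compound matrix: the matrix of the `k`-th exterior power of the linear map
given by `P`. -/
noncomputable def compound (k : ℕ) (P : Matrix m m ℂ) :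
    Matrix (Set.powersetCard m k) (Set.powersetCard m k) ℂ :=
  LinearMap.toMatrix ((Pi.basisFun ℂ m).exteriorPower k) ((Pi.basisFun ℂ m).exteriorPower k)
    (exteriorPower.map k (Matrix.toLin' P))

lemma compound_apply (k : ℕ) (P : Matrix m m ℂ) (s t : Set.powersetCard m k) :
    compound k P s t = (P.submatrix (ofFinEmbEquiv.symm s) (ofFinEmbEquiv.symm t)).det := by
  rw [compound, LinearMap.toMatrix_apply, exteriorPower.basis_apply,
    exteriorPower.map_apply_ιMulti_family, exteriorPower.basis_repr_apply,
    exteriorPower.ιMulti_family, exteriorPower.ιMultiDual_apply_ιMulti, ← det_transpose]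
  congr 1
  ext i j
  simp

lemma compound_one (k : ℕ) : compound k (1 : Matrix m m ℂ) = 1 := by
  rw [compound, toLin'_one, exteriorPower.map_id, LinearMap.toMatrix_id]

lemma compound_mul (k : ℕ) (P Q : Matrix m m ℂ) :
    compound k (P * Q) = compound k P * compound k Q := by
  rw [compound, toLin'_mul, exteriorPower.map_comp, LinearMap.toMatrix_comp _
    ((Pi.basisFun ℂ m).exteriorPower k)]
  rfl

lemma compound_conjTranspose (k : ℕ) (P : Matrix m m ℂ) :
    compound k Pᴴ = (compound k P)ᴴ := by
  ext s t
  rw [conjTranspose_apply, compound_apply, compound_apply, ← det_conjTranspose,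
    conjTranspose_submatrix]

lemma compound_mem_unitaryGroup (k : ℕ) {U : Matrix m m ℂ} (hU : U ∈ unitaryGroup m ℂ) :
    compound k U ∈ unitaryGroup (Set.powersetCard m k) ℂ := by
  have h : U * Uᴴ = 1 := mem_unitaryGroup_iff.1 hU
  rw [mem_unitaryGroup_iff, star_eq_conjTranspose, ← compound_conjTranspose, ← compound_mul, h,
    compound_one]

lemma compound_diagonal (k : ℕ) (d : m → ℂ) :
    compound k (diagonal d) = diagonal fun s => ∏ i ∈ s.val, d i := by
  ext s t
  rw [compound_apply]
  by_cases hst : s = t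
  · subst hst
    rw [submatrix_diagonal _ _ (ofFinEmbEquiv.symm s).injective, det_diagonal,
      diagonal_apply_eq (fun s : Set.powersetCard m k => ∏ i ∈ s.val, d i)]
    have hs : s.val = Finset.univ.map (ofFinEmbEquiv.symm s).toEmbedding := by
      ext i
      refine (mem_range_ofFinEmbEquiv_symm_iff_mem s i).symm.trans ?_
      simp [eq_comm]
    rw [hs, Finset.prod_map]
    rfl
  · rw [diagonal_apply_ne _ hst]
    obtain ⟨i, his, hit⟩ := (exists_mem_notMem_iff_ne s t).mp hst
    obtain ⟨l, rfl⟩ := (mem_range_ofFinEmbEquiv_symm_iff_mem s i).mpr his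
    refine det_eq_zero_of_row_eq_zero l fun j => diagonal_apply_ne _ fun h => hit ?_
    rw [h]
    exact (mem_range_ofFinEmbEquiv_symm_iff_mem t _).mp ⟨j, rfl⟩

lemma compound_spectralForm (k : ℕ) (U : Matrix m m ℂ) (d : m → ℝ) :
    compound k (spectralForm U d) = spectralForm (compound k U) fun s => ∏ i ∈ s.val, d i := by
  rw [spectralForm, compound_mul, compound_mul, compound_diagonal, compound_conjTranspose]
  simp [spectralForm]

lemma Matrix.PosSemidef.compound (k : ℕ) {P : Matrix m m ℂ} (hP : P.PosSemidef) :
    (compound k P).PosSemidef := by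
  obtain ⟨U, hU, d, hd, rfl⟩ := hP.exists_eq_spectralForm
  rw [compound_spectralForm]
  exact posSemidef_spectralForm _ fun s => Finset.prod_nonneg fun i _ => hd i

lemma compound_mrpow (k : ℕ) {P : Matrix m m ℂ} (hP : P.PosSemidef) (r : ℝ) :
    compound k (mrpow P r) = mrpow (compound k P) r := by
  obtain ⟨U, hU, d, hd, rfl⟩ := hP.exists_eq_spectralForm
  rw [mrpow_spectralForm hU, compound_spectralForm, compound_spectralForm,
    mrpow_spectralForm (compound_mem_unitaryGroup k hU)]
  congr 1
  ext s
  exact Real.finsetProd_rpow _ _ (fun i _ => hd i) r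

open scoped Matrix.Norms.L2Operator in
/-- Weak log-majorization between the eigenvalues of `X ^ θ * Y ^ θ * X ^ θ` and the `θ`-th powers
of the eigenvalues of `X * Y * X`. -/
lemma exists_prod_le_prod_rpow {X Y : Matrix m m ℂ} (hX : X.PosSemidef) (hY : Y.PosSemidef)
    {θ : ℝ} (hθ : θ ∈ Set.Icc (0 : ℝ) 1) {U V : Matrix m m ℂ} (hU : U ∈ unitaryGroup m ℂ)
    (hV : V ∈ unitaryGroup m ℂ) {x y : m → ℝ} (hy : ∀ i, 0 ≤ y i)
    (hUx : mrpow X θ * mrpow Y θ * mrpow X θ = spectralForm U x)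
    (hVy : X * Y * X = spectralForm V y) (S : Finset m) :
    ∃ T : Finset m, T.card = S.card ∧ ∏ i ∈ S, x i ≤ ∏ i ∈ T, y i ^ θ := by
  have h := norm_mrpow_mul_mrpow_mul_mrpow_le (hX.compound S.card) (hY.compound S.card) hθ
  rw [← compound_mrpow _ hX, ← compound_mrpow _ hY, ← compound_mul, ← compound_mul,
    ← compound_mul, ← compound_mul, hUx, hVy, compound_spectralForm, compound_spectralForm,
    norm_spectralForm (compound_mem_unitaryGroup _ hU),
    norm_spectralForm (compound_mem_unitaryGroup _ hV)] at h
  have hne : Nonempty (Set.powersetCard m S.card) := ⟨⟨S, rfl⟩⟩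
  obtain ⟨T, hT⟩ := Finite.exists_max fun s : Set.powersetCard m S.card => ∏ i ∈ s.val, y i
  have hnn : ∀ s : Finset m, 0 ≤ ∏ i ∈ s, y i := fun s => Finset.prod_nonneg fun i _ => hy i
  refine ⟨T.val, T.prop, ?_⟩
  rw [Real.finsetProd_rpow _ _ fun i _ => hy i]
  calc ∏ i ∈ S, x i ≤ ‖∏ i ∈ S, x i‖ := Real.le_norm_self _
    _ ≤ _ := norm_le_pi_norm (fun s : Set.powersetCard m S.card => ∏ i ∈ s.val, x i) ⟨S, rfl⟩
    _ ≤ _ := h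
    _ ≤ _ := by
      refine Real.rpow_le_rpow (norm_nonneg _) ((pi_norm_le_iff_of_nonneg (hnn _)).2 fun s => ?_)
        hθ.1
      rw [Real.norm_of_nonneg (hnn _)]
      exact hT s

end Compound

section LogMajorization

lemma sum_range_le_sum_range_of_prod_le {x z : ℕ → ℝ} (hx : Antitone x) (hx0 : ∀ i, 0 ≤ x i)
    (hz0 : ∀ i, 0 ≤ z i) (N : ℕ)
    (h : ∀ k ≤ N, ∏ i ∈ Finset.range k, x i ≤ ∏ i ∈ Finset.range k, z i) :
    ∑ i ∈ Finset.range N, x i ≤ ∑ i ∈ Finset.range N, z i := by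
  induction N with
  | zero => simp
  | succ N ih =>
    rcases (hx0 N).eq_or_lt with hN | hN
    · rw [Finset.sum_range_succ, Finset.sum_range_succ, ← hN]
      linarith [ih fun k hk => h k (hk.trans N.le_succ), hz0 N]
    have hxpos : ∀ i ≤ N, 0 < x i := fun i hi => hN.trans_le (hx hi)
    have hPx : ∀ k ≤ N + 1, 0 < ∏ i ∈ Finset.range k, x i := fun k hk =>
      Finset.prod_pos fun i hi => hxpos i (by have := Finset.mem_range.1 hi; omega)
    have hzpos : ∀ i ≤ N, 0 < z i := fun i hi => by
      refine (hz0 i).lt_of_ne' fun hzi => ?_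
      have h1 := (hPx (i + 1) (by omega)).trans_le (h (i + 1) (by omega))
      rw [Finset.prod_range_succ, hzi, mul_zero] at h1
      exact h1.false
    have hL : ∀ k ≤ N + 1, 0 ≤ ∑ i ∈ Finset.range k, (Real.log (z i) - Real.log (x i)) := by
      intro k hk
      have hne : ∀ i ∈ Finset.range k, x i ≠ 0 ∧ z i ≠ 0 := fun i hi => by
        have hi := Finset.mem_range.1 hi
        exact ⟨(hxpos i (by omega)).ne', (hzpos i (by omega)).ne'⟩
      rw [Finset.sum_sub_distrib, ← Real.log_prod fun i hi => (hne i hi).1,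
        ← Real.log_prod fun i hi => (hne i hi).2]
      exact sub_nonneg.2 (Real.log_le_log (hPx k hk) (h k hk))
    have key : ∀ k ≤ N + 1, x k * ∑ i ∈ Finset.range k, (Real.log (z i) - Real.log (x i)) ≤
        ∑ i ∈ Finset.range k, (z i - x i) := by
      intro k hk
      induction k with
      | zero => simp
      | succ k ihk =>
        have hkx := hxpos k (by omega)
        have hlog : x k * (Real.log (z k) - Real.log (x k)) ≤ z k - x k := by
          have h1 := Real.log_le_sub_one_of_pos (div_pos (hzpos k (by omega)) hkx)
          rw [Real.log_div (hzpos k (by omega)).ne' hkx.ne'] at h1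
          have h2 := mul_le_mul_of_nonneg_left h1 hkx.le
          rwa [mul_sub (x k) (z k / x k), mul_div_cancel₀ _ hkx.ne', mul_one] at h2
        refine (mul_le_mul_of_nonneg_right (hx k.le_succ) (hL (k + 1) hk)).trans ?_
        rw [Finset.sum_range_succ, Finset.sum_range_succ, mul_add]
        exact add_le_add (ihk (by omega)) hlog
    have h1 := (mul_nonneg (hx0 _) (hL (N + 1) le_rfl)).trans (key (N + 1) le_rfl)
    rw [Finset.sum_sub_distrib] at h1
    exact sub_nonneg.1 h1

lemma exists_equiv_antitone {m : Type*} [Fintype m] {x : m → ℝ} (hx : ∀ i, 0 ≤ x i) :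
    ∃ (e : Fin (Fintype.card m) ≃ m) (u : ℕ → ℝ), Antitone u ∧ (∀ i, 0 ≤ u i) ∧
      ∀ i : Fin (Fintype.card m), u i = x (e i) := by
  let e₀ := (Fintype.equivFin m).symm
  let e := (Tuple.sort fun i => -x (e₀ i)).trans e₀
  have he : Antitone fun i => x (e i) := fun i j hij =>
    neg_le_neg_iff.1 (Tuple.monotone_sort (fun i => -x (e₀ i)) hij)
  refine ⟨e, fun i => if h : i < Fintype.card m then x (e ⟨i, h⟩) else 0, fun i j hij => ?_,
    fun i => ?_, fun i => by simp⟩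
  · dsimp only
    split_ifs with hj hi
    · exact he (Fin.mk_le_mk.2 hij)
    · omega
    · exact hx _
    · exact le_rfl
  · dsimp only
    split_ifs
    exacts [hx _, le_rfl]

lemma StrictMono.fin_val_le {k N : ℕ} {g : Fin k → Fin N} (hg : StrictMono g) (i : Fin k) :
    (i : ℕ) ≤ g i := by
  obtain ⟨i, hi⟩ := i
  induction i with
  | zero => exact Nat.zero_le _
  | succ i ih =>
    have h : g ⟨i, by omega⟩ < g ⟨i + 1, hi⟩ := hg (Fin.mk_lt_mk.2 i.lt_succ_self)
    exact (ih (by omega)).trans_lt (Fin.lt_def.1 h)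

lemma sum_le_sum_of_exists_prod_le {m : Type*} [Fintype m] {x z : m → ℝ} (hx : ∀ i, 0 ≤ x i)
    (hz : ∀ i, 0 ≤ z i)
    (h : ∀ S : Finset m, ∃ T : Finset m, T.card = S.card ∧ ∏ i ∈ S, x i ≤ ∏ i ∈ T, z i) :
    ∑ i, x i ≤ ∑ i, z i := by
  obtain ⟨e, u, hu, hu0, hux⟩ := exists_equiv_antitone hx
  obtain ⟨f, v, hv, hv0, hvz⟩ := exists_equiv_antitone hz
  rw [← e.sum_comp, ← f.sum_comp, ← Finset.sum_congr rfl fun i _ => hux i,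
    ← Finset.sum_congr rfl fun i _ => hvz i, Fin.sum_univ_eq_sum_range, Fin.sum_univ_eq_sum_range]
  refine sum_range_le_sum_range_of_prod_le hu hu0 hv0 _ fun k hk => ?_
  obtain ⟨T, hTc, hT⟩ := h (Finset.univ.map ((Fin.castLEEmb hk).trans e.toEmbedding))
  rw [Finset.card_map, Finset.card_fin] at hTc
  have hTc' : (T.map f.symm.toEmbedding).card = k := by rw [Finset.card_map, hTc]
  calc ∏ i ∈ Finset.range k, u i
      = ∏ i ∈ Finset.univ.map ((Fin.castLEEmb hk).trans e.toEmbedding), x i := by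
        rw [Finset.prod_map, ← Fin.prod_univ_eq_prod_range]
        exact Finset.prod_congr rfl fun i _ => hux (Fin.castLE hk i)
    _ ≤ _ := hT
    _ = ∏ j ∈ T.map f.symm.toEmbedding, v j := by
        rw [Finset.prod_map]
        exact Finset.prod_congr rfl fun i _ => by simp [hvz]
    _ = ∏ i : Fin k, v ((T.map f.symm.toEmbedding).orderEmbOfFin hTc' i) := by
        conv_lhs => rw [← Finset.map_orderEmbOfFin_univ _ hTc', Finset.prod_map]
        rfl
    _ ≤ ∏ i : Fin k, v i := by
        refine Finset.prod_le_prod (fun i _ => hv0 _) fun i _ => hv ?_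
        exact ((T.map f.symm.toEmbedding).orderEmbOfFin hTc').strictMono.fin_val_le i
    _ = _ := Fin.prod_univ_eq_prod_range v k

end LogMajorization

theorem stmt1 {n : Type*} [Fintype n] [DecidableEq n] (A B : Matrix n n ℂ)
    (hA : A.PosSemidef) (hB : B.PosSemidef) (r q : ℝ) (hr : 1 ≤ r) (hq : 0 ≤ q) :
    (mrpow (A * B * A) (r * q)).trace ≤
      (mrpow (mrpow A r * mrpow B r * mrpow A r) q).trace := by
  let _ : LinearOrder n := LinearOrder.lift' (Fintype.equivFin n) (Fintype.equivFin n).injective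
  have hr0 : r ≠ 0 := by positivity
  obtain ⟨U, hU, x, hx, hUx⟩ := (hA.mul_mul_self hB).exists_eq_spectralForm
  obtain ⟨V, hV, y, hy, hVy⟩ := ((hA.mrpow r).mul_mul_self (hB.mrpow r)).exists_eq_spectralForm
  rw [hUx, hVy, mrpow_spectralForm hU, mrpow_spectralForm hV, trace_spectralForm hU,
    trace_spectralForm hV, Complex.real_le_real]
  refine sum_le_sum_of_exists_prod_le (fun i => Real.rpow_nonneg (hx i) _)
    (fun i => Real.rpow_nonneg (hy i) _) fun S => ?_
  obtain ⟨T, hTc, hT⟩ := exists_prod_le_prod_rpow (hA.mrpow r) (hB.mrpow r)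
    ⟨by positivity, inv_le_one_of_one_le₀ hr⟩ hU hV hy
    (by rw [mrpow_mrpow_inv hA hr0, mrpow_mrpow_inv hB hr0, hUx]) hVy S
  refine ⟨T, hTc, ?_⟩
  rw [Real.finsetProd_rpow _ _ fun i _ => hx i]
  refine (Real.rpow_le_rpow (Finset.prod_nonneg fun i _ => hx i) hT (by positivity)).trans ?_
  rw [← Real.finsetProd_rpow _ _ fun i _ => Real.rpow_nonneg (hy i) _]
  refine (Finset.prod_congr rfl fun i _ => ?_).le
  rw [← Real.rpow_mul (hy i), inv_mul_cancel_left₀ hr0]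
end

section
/- For a density matrix ρ and parameters α, z with 0 < max{α, 1-α} ≤ z < 1, the quantity M(ρ) = 1 - Tr[((ρ*)^{(1-α)/(2z)} ρ^{α/z} (ρ*)^{(1-α)/(2z)})^z] equals 0 if and only if ρ = ρ*, i.e., all entries of ρ are real. -/
open Matrix ComplexOrder Kronecker

lemma mrpow_eq {n : Type*} [Fintype n] [DecidableEq n] {A : Matrix n n ℂ}
    (h : A.IsHermitian) (r : ℝ) :
    mrpow A r = (h.eigenvectorUnitary : Matrix n n ℂ) *
      Matrix.diagonal ((fun i => (((h.eigenvalues i : ℝ) ^ r : ℝ) : ℂ)) : n → ℂ) *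
      star (h.eigenvectorUnitary : Matrix n n ℂ) :=
  dif_pos h

lemma mrpow_eq_cfc {n : Type*} [Fintype n] [DecidableEq n] {A : Matrix n n ℂ}
    (h : A.IsHermitian) (r : ℝ) : mrpow A r = cfc (fun x : ℝ => x ^ r) A := by
  rw [h.cfc_eq, mrpow_eq h]
  rfl

lemma isHermitian_mrpow {n : Type*} [Fintype n] [DecidableEq n] {A : Matrix n n ℂ}
    (h : A.IsHermitian) (r : ℝ) : (mrpow A r).IsHermitian := by
  rw [mrpow_eq_cfc h]
  exact cfc_predicate _ A

lemma spectrum_nonneg_of_posSemidef {n : Type*} [Fintype n] [DecidableEq n] {A : Matrix n n ℂ}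
    (h : A.PosSemidef) {x : ℝ} (hx : x ∈ spectrum ℝ A) : 0 ≤ x := by
  rw [h.isHermitian.spectrum_real_eq_range_eigenvalues] at hx
  obtain ⟨i, rfl⟩ := hx
  exact h.eigenvalues_nonneg i

lemma mrpow_mul_mrpow {n : Type*} [Fintype n] [DecidableEq n] {A : Matrix n n ℂ}
    (h : A.PosSemidef) {r s : ℝ} (hr : 0 < r) (hs : 0 < s) :
    mrpow A r * mrpow A s = mrpow A (r + s) := by
  have hc (r : ℝ) : ContinuousOn (fun x : ℝ => x ^ r) (spectrum ℝ A) :=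
    Matrix.finite_real_spectrum.continuousOn _
  rw [mrpow_eq_cfc h.1, mrpow_eq_cfc h.1, mrpow_eq_cfc h.1, ← cfc_mul _ _ A (hc r) (hc s)]
  exact cfc_congr fun x hx =>
    (Real.rpow_add_of_nonneg (spectrum_nonneg_of_posSemidef h hx) hr.le hs.le).symm

lemma mrpow_one {n : Type*} [Fintype n] [DecidableEq n] {A : Matrix n n ℂ}
    (h : A.IsHermitian) : mrpow A 1 = A := by
  rw [mrpow_eq_cfc h]
  simp only [Real.rpow_one]
  exact cfc_id' ℝ A h

lemma mrpow_mrpow_inv_s3 {n : Type*} [Fintype n] [DecidableEq n] {A : Matrix n n ℂ}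
    (h : A.PosSemidef) {r : ℝ} (hr : r ≠ 0) : mrpow (mrpow A r⁻¹) r = A := by
  rw [mrpow_eq_cfc (isHermitian_mrpow h.1 _), mrpow_eq_cfc h.1]
  refine (cfc_comp' (fun x : ℝ => x ^ r) (fun x : ℝ => x ^ r⁻¹) A
    ((Matrix.finite_real_spectrum.image _).continuousOn _)
    (Matrix.finite_real_spectrum.continuousOn _) h.1).symm.trans ?_
  conv_rhs => rw [← cfc_id' ℝ A h.1]
  exact cfc_congr fun x hx => Real.rpow_inv_rpow (spectrum_nonneg_of_posSemidef h hx) hr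

lemma trace_mrpow {n : Type*} [Fintype n] [DecidableEq n] {A : Matrix n n ℂ}
    (h : A.IsHermitian) (r : ℝ) :
    (mrpow A r).trace = ((∑ i, h.eigenvalues i ^ r : ℝ) : ℂ) := by
  rw [mrpow_eq h, Matrix.trace_mul_comm, ← mul_assoc]
  simp [Matrix.trace_diagonal]

lemma inner_eigenvectorBasis_mrpow {n : Type*} [Fintype n] [DecidableEq n] {A : Matrix n n ℂ}
    (h : A.IsHermitian) (r : ℝ) (i : n) (x : EuclideanSpace ℂ n) :
    inner ℂ (h.eigenvectorBasis i) (toEuclideanLin (mrpow A r) x) =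
      ((h.eigenvalues i ^ r : ℝ) : ℂ) * inner ℂ (h.eigenvectorBasis i) x := by
  have hs := Matrix.isSymmetric_toEuclideanLin_iff.2 (isHermitian_mrpow h r)
  have he : toEuclideanLin (mrpow A r) (h.eigenvectorBasis i) =
      ((h.eigenvalues i ^ r : ℝ) : ℂ) • h.eigenvectorBasis i := by
    rw [toLpLin_apply, mrpow_eq h, ← mulVec_mulVec, ← mulVec_mulVec,
      h.star_eigenvectorUnitary_mulVec]
    simp
  rw [← hs, he, inner_smul_left, Complex.conj_ofReal]

lemma norm_sq_mrpow {n : Type*} [Fintype n] [DecidableEq n] {A : Matrix n n ℂ}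
    (h : A.PosSemidef) (t : ℝ) (x : EuclideanSpace ℂ n) :
    ‖toEuclideanLin (mrpow A (t / 2)) x‖ ^ 2 =
      ∑ i, ‖inner ℂ (h.1.eigenvectorBasis i) x‖ ^ 2 * h.1.eigenvalues i ^ t := by
  rw [← h.1.eigenvectorBasis.sum_sq_norm_inner_right]
  refine Finset.sum_congr rfl fun i _ => ?_
  have h0 := h.eigenvalues_nonneg i
  rw [inner_eigenvectorBasis_mrpow, norm_mul, mul_pow, mul_comm, Complex.norm_real,
    Real.norm_of_nonneg (by positivity), ← Real.rpow_mul_natCast h0]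
  norm_num

lemma sum_norm_sq_mrpow_half {n : Type*} [Fintype n] [DecidableEq n] {A : Matrix n n ℂ}
    (h : A.PosSemidef) (htr : A.trace = 1)
    (f : OrthonormalBasis n ℂ (EuclideanSpace ℂ n)) :
    ∑ k, ‖toEuclideanLin (mrpow A (1 / 2)) (f k)‖ ^ 2 = 1 := by
  simp_rw [norm_sq_mrpow h 1]
  rw [Finset.sum_comm]
  simp_rw [← Finset.sum_mul, f.sum_sq_norm_inner_left]
  have := h.1.trace_eq_sum_eigenvalues
  rw [htr] at this
  exact Complex.ofReal_injective (by simpa using this.symm)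

lemma norm_mrpow_le {n : Type*} [Fintype n] [DecidableEq n] {A : Matrix n n ℂ}
    (h : A.PosSemidef) {t : ℝ} (ht : 0 < t) (ht1 : t ≤ 1) {x : EuclideanSpace ℂ n}
    (hx : ‖x‖ = 1) :
    ‖toEuclideanLin (mrpow A (t / 2)) x‖ ≤ ‖toEuclideanLin (mrpow A (1 / 2)) x‖ ^ t := by
  refine le_of_sq_le_sq ?_ (by positivity)
  rw [← Real.rpow_mul_natCast (norm_nonneg _), mul_comm, Real.rpow_mul (norm_nonneg _),
    Real.rpow_natCast, norm_sq_mrpow h t, norm_sq_mrpow h 1]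
  have hw : ∑ i, ‖inner ℂ (h.1.eigenvectorBasis i) x‖ ^ 2 = 1 := by
    rw [h.1.eigenvectorBasis.sum_sq_norm_inner_right, hx, one_pow]
  simpa using (Real.concaveOn_rpow ht.le ht1).le_map_sum (t := Finset.univ)
    (w := fun i => ‖inner ℂ (h.1.eigenvectorBasis i) x‖ ^ 2) (p := h.1.eigenvalues)
    (fun i _ => by positivity) hw (fun i _ => h.eigenvalues_nonneg i)

lemma mrpow_half_eq_of_norm_eq {n : Type*} [Fintype n] [DecidableEq n] {A : Matrix n n ℂ}
    (h : A.PosSemidef) {t : ℝ} (ht : 0 < t) (ht1 : t ≤ 1) {x : EuclideanSpace ℂ n}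
    (hx : ‖x‖ = 1)
    (heq : ‖toEuclideanLin (mrpow A (t / 2)) x‖ = ‖toEuclideanLin (mrpow A (1 / 2)) x‖ ^ t) :
    toEuclideanLin (mrpow A (1 / 2)) x =
      ((‖toEuclideanLin (mrpow A (1 / 2)) x‖ ^ (1 - t) : ℝ) : ℂ) •
        toEuclideanLin (mrpow A (t / 2)) x := by
  rcases ht1.eq_or_lt with rfl | ht1
  · simp
  have hw : ∑ i, ‖inner ℂ (h.1.eigenvectorBasis i) x‖ ^ 2 = 1 := by
    rw [h.1.eigenvectorBasis.sum_sq_norm_inner_right, hx, one_pow]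
  have hsq := congrArg (· ^ 2) heq
  have hp := norm_sq_mrpow h 1 x
  rw [← Real.rpow_mul_natCast (norm_nonneg _), mul_comm, Real.rpow_mul (norm_nonneg _),
    Real.rpow_natCast, norm_sq_mrpow h t, hp] at hsq
  have key := (Real.strictConcaveOn_rpow ht ht1).map_sum_eq_iff_of_nonneg (t := Finset.univ)
    (w := fun i => ‖inner ℂ (h.1.eigenvectorBasis i) x‖ ^ 2) (p := h.1.eigenvalues)
    (fun i _ => by positivity) hw (fun i _ => h.eigenvalues_nonneg i) |>.1
    (by simpa using hsq.symm)
  refine InnerProductSpace.ext_inner_left_basis h.1.eigenvectorBasis.toBasis fun i => ?_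
  rw [OrthonormalBasis.coe_toBasis, inner_smul_right, inner_eigenvectorBasis_mrpow, inner_eigenvectorBasis_mrpow]
  by_cases hi : inner ℂ (h.1.eigenvectorBasis i) x = 0
  · simp [hi]
  have h0 := h.eigenvalues_nonneg i
  have hp' : ‖toEuclideanLin (mrpow A (1 / 2)) x‖ ^ 2 = h.1.eigenvalues i := by
    rw [hp]
    refine Eq.trans ?_ (one_mul (h.1.eigenvalues i))
    rw [← hw, Finset.sum_mul]
    refine Finset.sum_congr rfl fun j _ => ?_
    by_cases hj : inner ℂ (h.1.eigenvectorBasis j) x = 0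
    · simp [hj]
    · rw [hw, Real.rpow_one, key (Finset.mem_univ j) (by simpa using hj) (Finset.mem_univ i)
        (by simpa using hi)]
  have hn : ‖toEuclideanLin (mrpow A (1 / 2)) x‖ = h.1.eigenvalues i ^ (1 / 2 : ℝ) := by
    rw [← hp', ← Real.sqrt_eq_rpow, Real.sqrt_sq (norm_nonneg _)]
  rw [hn, ← mul_assoc, ← Complex.ofReal_mul, ← Real.rpow_mul h0,
    ← Real.rpow_add_of_nonneg h0 (by nlinarith) (by positivity)]
  congr 4
  ring

lemma eq_of_mrpow_half_eq {n : Type*} [Fintype n] [DecidableEq n] {A B : Matrix n n ℂ}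
    (hA : A.PosSemidef) (hB : B.PosSemidef) (f w : OrthonormalBasis n ℂ (EuclideanSpace ℂ n))
    (hfw : ∀ k, toEuclideanLin (mrpow A (1 / 2)) (f k) = toEuclideanLin (mrpow B (1 / 2)) (w k)) :
    A = B := by
  have key {C : Matrix n n ℂ} (hC : C.PosSemidef)
      (g : OrthonormalBasis n ℂ (EuclideanSpace ℂ n)) (x y : EuclideanSpace ℂ n) :
      inner ℂ x (toEuclideanLin C y) = ∑ k, inner ℂ x (toEuclideanLin (mrpow C (1 / 2)) (g k)) *
        inner ℂ (toEuclideanLin (mrpow C (1 / 2)) (g k)) y := by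
    have hs := Matrix.isSymmetric_toEuclideanLin_iff.2 (isHermitian_mrpow hC.1 (1 / 2))
    have hm : toEuclideanLin C y =
        toEuclideanLin (mrpow C (1 / 2)) (toEuclideanLin (mrpow C (1 / 2)) y) := by
      conv_lhs => rw [← mrpow_one hC.1, ← add_halves (1 : ℝ),
        ← mrpow_mul_mrpow hC one_half_pos one_half_pos]
      simp [toLpLin_apply]
    simp_rw [← hs x, hs _ y]
    rw [g.sum_inner_mul_inner, hm, hs]
  apply toEuclideanLin.injective
  refine LinearMap.ext fun y => ext_inner_left ℂ fun x => ?_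
  rw [key hA f, key hB w]
  simp_rw [hfw]

/-- Singular value decomposition of a square complex matrix, in terms of the eigenvalues of
`Mᴴ * M`. -/
lemma exists_orthonormalBasis_svd {n : Type*} [Fintype n] [DecidableEq n] (M : Matrix n n ℂ)
    (h : (Mᴴ * M).IsHermitian) :
    ∃ f : OrthonormalBasis n ℂ (EuclideanSpace ℂ n), ∀ k,
      toEuclideanLin M (h.eigenvectorBasis k) = ((√(h.eigenvalues k) : ℝ) : ℂ) • f k := by
  set w := h.eigenvectorBasis
  have hin (k l : n) : inner ℂ (toEuclideanLin M (w k)) (toEuclideanLin M (w l)) =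
      (h.eigenvalues l : ℂ) * inner ℂ (w k) (w l) := by
    rw [← LinearMap.adjoint_inner_right, ← toEuclideanLin_conjTranspose_eq_adjoint]
    have : toEuclideanLin Mᴴ (toEuclideanLin M (w l)) = (h.eigenvalues l : ℂ) • w l := by
      have := h.mulVec_eigenvectorBasis l
      rw [← mulVec_mulVec] at this
      rw [toLpLin_apply, toLpLin_apply, this]
      rfl
    rw [this, inner_smul_right]
  have h0 (k : n) : 0 ≤ h.eigenvalues k := (posSemidef_conjTranspose_mul_self M).eigenvalues_nonneg k
  have hon : Orthonormal ℂ (Set.domRestrict {k | h.eigenvalues k ≠ 0}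
      fun k => (((√(h.eigenvalues k))⁻¹ : ℝ) : ℂ) • toEuclideanLin M (w k)) := by
    rw [orthonormal_iff_ite]
    rintro ⟨k, hk⟩ ⟨l, hl⟩
    simp only [Set.domRestrict_apply, inner_smul_left, inner_smul_right, hin, Complex.conj_ofReal,
      Subtype.mk.injEq, orthonormal_iff_ite.1 w.orthonormal]
    split_ifs with hkl
    · subst hkl
      have : √(h.eigenvalues k) ≠ 0 := (Real.sqrt_pos.2 ((h0 k).lt_of_ne' hk)).ne'
      norm_cast
      nth_rw 3 [← Real.mul_self_sqrt (h0 k)]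
      field_simp
    · simp
  obtain ⟨f, hf⟩ := hon.exists_orthonormalBasis_extension_of_card_eq (by simp)
  refine ⟨f, fun k => ?_⟩
  by_cases hk : h.eigenvalues k = 0
  · have := hin k k
    rw [hk] at this
    simp only [Complex.ofReal_zero, zero_mul, inner_self_eq_zero] at this
    simp [this, hk]
  · have : √(h.eigenvalues k) ≠ 0 := (Real.sqrt_pos.2 ((h0 k).lt_of_ne' hk)).ne'
    rw [hf k hk, smul_smul, ← Complex.ofReal_mul, mul_inv_cancel₀ this]
    simp

lemma eq_of_rpow_mul_rpow_eq {a p q : ℝ} (ha : 0 < a) (ha1 : a < 1) (hp : 0 ≤ p) (hq : 0 ≤ q)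
    (h : p ^ a * q ^ (1 - a) = a * p + (1 - a) * q) : p = q := by
  have := (Real.geom_mean_eq_arith_mean_weighted_iff_of_pos' (Finset.univ : Finset (Fin 2))
    ![a, 1 - a] ![p, q] (by simp [Fin.forall_fin_two, ha, ha1]) (by simp)
    (by simp [Fin.forall_fin_two, hp, hq])).1 (by simpa using h)
  have h0 := this 0 (by simp)
  have h1 := this 1 (by simp)
  simp at h0 h1
  linarith

lemma norm_holder_and_eq {E : Type*} [NormedAddCommGroup E] [InnerProductSpace ℂ E] {a z : ℝ}
    (ha : 0 < a) (ha1 : a < 1) (hz : 0 < z) {R S X Y : E}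
    (hX : ‖X‖ ≤ ‖R‖ ^ (a / z)) (hY : ‖Y‖ ≤ ‖S‖ ^ ((1 - a) / z))
    (hXe : ‖X‖ = ‖R‖ ^ (a / z) → R = ((‖R‖ ^ (1 - a / z) : ℝ) : ℂ) • X)
    (hYe : ‖Y‖ = ‖S‖ ^ ((1 - a) / z) → S = ((‖S‖ ^ (1 - (1 - a) / z) : ℝ) : ℂ) • Y)
    {c : ℝ} (hc : 0 ≤ c) (h : inner ℂ X Y = (c : ℂ)) :
    c ^ (2 * z) ≤ a * ‖R‖ ^ 2 + (1 - a) * ‖S‖ ^ 2 ∧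
    (c ^ (2 * z) = a * ‖R‖ ^ 2 + (1 - a) * ‖S‖ ^ 2 → R = S) := by
  have hcs : c ≤ ‖X‖ * ‖Y‖ := by
    have := norm_inner_le_norm (𝕜 := ℂ) X Y
    rwa [h, Complex.norm_real, Real.norm_of_nonneg hc] at this
  have hXY : ‖X‖ * ‖Y‖ ≤ ‖R‖ ^ (a / z) * ‖S‖ ^ ((1 - a) / z) := by gcongr
  have hpow : (‖R‖ ^ (a / z) * ‖S‖ ^ ((1 - a) / z)) ^ (2 * z) =
      (‖R‖ ^ 2) ^ a * (‖S‖ ^ 2) ^ (1 - a) := by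
    rw [Real.mul_rpow (by positivity) (by positivity), ← Real.rpow_mul (norm_nonneg _),
      ← Real.rpow_mul (norm_nonneg _), ← Real.rpow_natCast_mul (norm_nonneg _),
      ← Real.rpow_natCast_mul (norm_nonneg _)]
    congr 2 <;> (push_cast; field_simp)
  have hle : c ^ (2 * z) ≤ (‖R‖ ^ 2) ^ a * (‖S‖ ^ 2) ^ (1 - a) := by
    rw [← hpow]
    exact Real.rpow_le_rpow hc (hcs.trans hXY) (by positivity)
  have ham := Real.geom_mean_le_arith_mean2_weighted ha.le (by linarith : 0 ≤ 1 - a)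
    (sq_nonneg ‖R‖) (sq_nonneg ‖S‖) (by ring)
  refine ⟨hle.trans ham, fun heq => ?_⟩
  have hRS : ‖R‖ = ‖S‖ := (sq_eq_sq₀ (norm_nonneg _) (norm_nonneg _)).1 <|
    eq_of_rpow_mul_rpow_eq ha ha1 (sq_nonneg _) (sq_nonneg _) (le_antisymm ham (heq ▸ hle))
  rcases (norm_nonneg R).eq_or_lt with hR0 | hR0
  · rw [norm_eq_zero.1 hR0.symm, norm_eq_zero.1 (hRS.symm.trans hR0.symm)]
  have hceq : c = ‖R‖ ^ (a / z) * ‖S‖ ^ ((1 - a) / z) := by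
    refine (Real.rpow_left_inj hc (by positivity) (by positivity : 2 * z ≠ 0)).1 ?_
    rw [hpow]
    exact le_antisymm hle (heq ▸ ham)
  have hS0 : 0 < ‖S‖ := hRS ▸ hR0
  have hXn : ‖X‖ = ‖R‖ ^ (a / z) := by
    refine hX.antisymm (le_of_mul_le_mul_right ?_ (Real.rpow_pos_of_pos hS0 ((1 - a) / z)))
    rw [← hceq]
    exact hcs.trans (by gcongr)
  have hYn : ‖Y‖ = ‖S‖ ^ ((1 - a) / z) := by
    refine hY.antisymm (le_of_mul_le_mul_left ?_ (Real.rpow_pos_of_pos hR0 (a / z)))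
    rw [← hceq]
    exact hcs.trans (by gcongr)
  have hin : inner ℂ R S = (‖R‖ : ℂ) * ‖S‖ := by
    have hsm : inner ℂ R S = inner ℂ (((‖R‖ ^ (1 - a / z) : ℝ) : ℂ) • X)
        (((‖S‖ ^ (1 - (1 - a) / z) : ℝ) : ℂ) • Y) := by
      rw [← hXe hXn, ← hYe hYn]
    rw [hsm, inner_smul_left, inner_smul_right, h, hceq, Complex.conj_ofReal]
    norm_cast
    rw [Real.rpow_sub hR0, Real.rpow_sub hS0, Real.rpow_one, Real.rpow_one]
    have := (Real.rpow_pos_of_pos hR0 (a / z)).ne'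
    have := (Real.rpow_pos_of_pos hS0 ((1 - a) / z)).ne'
    field_simp
  have := inner_eq_norm_mul_iff.1 hin
  rw [← hRS] at this
  exact smul_right_injective _ (by simpa using norm_pos_iff.1 hR0) this

section Holder

variable {n : Type*} [Fintype n] [DecidableEq n] {A B : Matrix n n ℂ} {a z : ℝ}

lemma fRenyi_eq_one_imp (hA : A.PosSemidef) (hB : B.PosSemidef) (hAt : A.trace = 1)
    (hBt : B.trace = 1) (ha : 0 < a) (ha1 : a < 1) (haz : a ≤ z) (haz' : 1 - a ≤ z)
    (h : fRenyi a z A B = 1) : A = B := by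
  have hz : 0 < z := ha.trans_le haz
  have ht : 0 < a / z := by positivity
  have hu : 0 < (1 - a) / z := div_pos (by linarith) hz
  have ht1 : a / z ≤ 1 := (div_le_one hz).2 haz
  have hu1 : (1 - a) / z ≤ 1 := (div_le_one hz).2 haz'
  have hX := isHermitian_mrpow hA.1 (a / z / 2)
  have hY := isHermitian_mrpow hB.1 ((1 - a) / z / 2)
  set X := mrpow A (a / z / 2) with hXdef
  set Y := mrpow B ((1 - a) / z / 2) with hYdef
  have hM : (X * Y)ᴴ * (X * Y) =
      mrpow B ((1 - a) / (2 * z)) * mrpow A (a / z) * mrpow B ((1 - a) / (2 * z)) := by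
    rw [conjTranspose_mul, hX.eq, hY.eq, ← add_halves (a / z), ← mrpow_mul_mrpow hA (half_pos ht) (half_pos ht),
      show (1 - a) / (2 * z) = (1 - a) / z / 2 by field_simp]
    simp only [mul_assoc, hXdef, hYdef]
  have hH := isHermitian_conjTranspose_mul_self (X * Y)
  rw [fRenyi, ← hM, trace_mrpow hH] at h
  have hsum : ∑ i, hH.eigenvalues i ^ z = 1 := by exact_mod_cast h
  obtain ⟨f, hf⟩ := exists_orthonormalBasis_svd (X * Y) hH
  set w := hH.eigenvectorBasis
  have hev (k : n) : 0 ≤ hH.eigenvalues k :=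
    (posSemidef_conjTranspose_mul_self (X * Y)).eigenvalues_nonneg k
  have key (k : n) := norm_holder_and_eq ha ha1 hz
    (norm_mrpow_le hA ht ht1 (f.norm_eq_one k)) (norm_mrpow_le hB hu hu1 (w.norm_eq_one k))
    (mrpow_half_eq_of_norm_eq hA ht ht1 (f.norm_eq_one k))
    (mrpow_half_eq_of_norm_eq hB hu hu1 (w.norm_eq_one k))
    (Real.sqrt_nonneg (hH.eigenvalues k)) (by
      rw [isSymmetric_toEuclideanLin_iff.2 hX]
      have : toEuclideanLin X (toEuclideanLin Y (w k)) = toEuclideanLin (X * Y) (w k) := by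
        simp [toLpLin_apply]
      rw [this, hf, inner_smul_right]
      simp)
  have hsq (k : n) : √(hH.eigenvalues k) ^ (2 * z) = hH.eigenvalues k ^ z := by
    rw [Real.rpow_mul (Real.sqrt_nonneg _), Real.rpow_two, Real.sq_sqrt (hev k)]
  simp_rw [hsq] at key
  have htot : ∑ k, (a * ‖toEuclideanLin (mrpow A (1 / 2)) (f k)‖ ^ 2 +
      (1 - a) * ‖toEuclideanLin (mrpow B (1 / 2)) (w k)‖ ^ 2) = 1 := by
    rw [Finset.sum_add_distrib, ← Finset.mul_sum, ← Finset.mul_sum,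
      sum_norm_sq_mrpow_half hA hAt, sum_norm_sq_mrpow_half hB hBt]
    ring
  have heq := (Finset.sum_eq_sum_iff_of_le fun k _ => (key k).1).1 (hsum.trans htot.symm)
  exact eq_of_mrpow_half_eq hA hB f w fun k => (key k).2 (heq k (Finset.mem_univ k))

lemma fRenyi_self (hA : A.PosSemidef) (hAt : A.trace = 1) (ha : 0 < a) (ha1 : a < 1)
    (hz : 0 < z) : fRenyi a z A A = 1 := by
  have ht : 0 < a / z := by positivity
  have hu : 0 < (1 - a) / (2 * z) := div_pos (by linarith) (by positivity)
  rw [fRenyi, mrpow_mul_mrpow hA hu ht, mrpow_mul_mrpow hA (by positivity) hu,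
    show (1 - a) / (2 * z) + a / z + (1 - a) / (2 * z) = z⁻¹ by field_simp; ring,
    mrpow_mrpow_inv_s3 hA hz.ne', hAt]

end Holder

theorem stmt3 {n : Type*} [Fintype n] [DecidableEq n] (ρ : Matrix n n ℂ)
    (hρ : ρ.PosSemidef) (htr : ρ.trace = 1) (α z : ℝ)
    (h0 : 0 < max α (1 - α)) (hz : max α (1 - α) ≤ z) (hz1 : z < 1) :
    1 - fRenyi α z ρ (conjM ρ) = 0 ↔ ρ = conjM ρ := by
  have hαz : α ≤ z := (le_max_left _ _).trans hz
  have hαz' : 1 - α ≤ z := (le_max_right _ _).trans hz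
  have hα : 0 < α := by linarith
  have hα1 : α < 1 := by linarith
  have hconj : conjM ρ = ρᵀ := by
    conv_rhs => rw [← hρ.1.eq]
    rfl
  rw [sub_eq_zero, eq_comm]
  constructor
  · intro h
    exact fRenyi_eq_one_imp hρ (hconj ▸ hρ.transpose) htr
      (by rw [hconj, trace_transpose, htr]) hα hα1 hαz hαz' h
  · intro h
    rw [← h]
    exact fRenyi_self hρ htr hα hα1 (h0.trans_le hz)
end

section
/- For any density matrix ρ and parameters α, z with 0 < max{α, 1-α} ≤ z < 1, f_{α,z}(ρ, ρ*) ≥ Tr[ρ^α (ρ*)^{1-α}]; hence M^R_{α,z}(ρ) ≤ M^T_α(ρ) = 1 - Tr[ρ^α (ρ*)^{1-α}]. -/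
open Matrix ComplexOrder Kronecker

open scoped Matrix.Norms.L2Operator

/-- The complex power `x ^ s` of a real number, with value `0` at `x = 0`, which makes it entire
in `s`. -/
noncomputable def suppCpow (x : ℝ) (s : ℂ) : ℂ := if x = 0 then 0 else (x : ℂ) ^ s

theorem suppCpow_add (x : ℝ) (s t : ℂ) : suppCpow x (s + t) = suppCpow x s * suppCpow x t := by
  unfold suppCpow
  split_ifs with h
  · simp
  · exact Complex.cpow_add _ _ (by exact_mod_cast h)

theorem suppCpow_ofReal {x r : ℝ} (hx : 0 ≤ x) (hr : r ≠ 0) :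
    suppCpow x r = ((x ^ r : ℝ) : ℂ) := by
  unfold suppCpow
  split_ifs with h
  · simp [h, Real.zero_rpow hr]
  · exact (Complex.ofReal_cpow hx r).symm

theorem norm_suppCpow_le {x : ℝ} (hx : 0 ≤ x) (s : ℂ) : ‖suppCpow x s‖ ≤ x ^ s.re := by
  unfold suppCpow
  split_ifs with h
  · simpa using Real.rpow_nonneg hx _
  · exact (Complex.norm_cpow_eq_rpow_re_of_pos (lt_of_le_of_ne hx (Ne.symm h)) s).le

/-- An entire function which is bounded on the strip `0 ≤ re w ≤ 1`. -/
def StripBounded (f : ℂ → ℂ) : Prop :=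
  Differentiable ℂ f ∧ ∃ M, ∀ w : ℂ, 0 ≤ w.re → w.re ≤ 1 → ‖f w‖ ≤ M

namespace StripBounded

theorem const (c : ℂ) : StripBounded fun _ => c :=
  ⟨differentiable_const c, ‖c‖, fun _ _ _ => le_rfl⟩

theorem mul {f g : ℂ → ℂ} (hf : StripBounded f) (hg : StripBounded g) :
    StripBounded fun w => f w * g w := by
  obtain ⟨hf, M, hM⟩ := hf
  obtain ⟨hg, N, hN⟩ := hg
  refine ⟨hf.mul hg, M * N, fun w h0 h1 => ?_⟩
  rw [norm_mul]
  exact mul_le_mul (hM w h0 h1) (hN w h0 h1) (norm_nonneg _)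
    ((norm_nonneg _).trans (hM w h0 h1))

theorem sum {ι : Type*} (s : Finset ι) {f : ι → ℂ → ℂ} (hf : ∀ i, StripBounded (f i)) :
    StripBounded fun w => ∑ i ∈ s, f i w := by
  choose hd M hM using hf
  exact ⟨Differentiable.fun_sum fun i _ => hd i, ∑ i ∈ s, M i, fun w h0 h1 =>
    (norm_sum_le _ _).trans (Finset.sum_le_sum fun i _ => hM i w h0 h1)⟩

theorem suppCpow {x : ℝ} (hx : 0 ≤ x) (c k : ℝ) :
    StripBounded fun w => suppCpow x (c + k * w) := by
  rcases hx.eq_or_lt with rfl | hx'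
  · simpa [_root_.suppCpow] using StripBounded.const 0
  · have hx0 : (x : ℂ) ≠ 0 := by exact_mod_cast hx'.ne'
    refine ⟨?_, ?_⟩
    · simp only [_root_.suppCpow, hx'.ne', if_false]
      intro w
      exact DifferentiableAt.const_cpow (by fun_prop) (Or.inl hx0)
    · have hc : ContinuousOn (fun u : ℝ => x ^ (c + k * u)) (Set.Icc 0 1) := by
        refine Continuous.continuousOn ?_
        exact Continuous.rpow continuous_const (by fun_prop) fun _ => Or.inl hx'.ne'
      obtain ⟨M, hM⟩ := isCompact_Icc.exists_bound_of_continuousOn hc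
      refine ⟨M, fun w h0 h1 => (norm_suppCpow_le hx _).trans ?_⟩
      have := (le_abs_self _).trans (hM w.re ⟨h0, h1⟩)
      simpa using this

theorem matrix_mul {n : Type*} [Fintype n] {F G : ℂ → Matrix n n ℂ}
    (hF : ∀ i j, StripBounded fun w => F w i j) (hG : ∀ i j, StripBounded fun w => G w i j)
    (i j : n) : StripBounded fun w => (F w * G w) i j := by
  simp only [Matrix.mul_apply]
  exact sum _ fun k => (hF i k).mul (hG k j)

theorem diagonal {n : Type*} [DecidableEq n] {f : n → ℂ → ℂ}
    (hf : ∀ i, StripBounded (f i)) (i j : n) :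
    StripBounded fun w => Matrix.diagonal (fun k => f k w) i j := by
  by_cases h : i = j
  · subst h
    simpa using hf i
  · simpa [h] using StripBounded.const 0

/-- The three lines theorem, on the strip `0 ≤ re w ≤ 1`. -/
theorem three_lines {f : ℂ → ℂ} (hf : StripBounded f) {a b x : ℝ} (h0 : 0 ≤ x) (h1 : x ≤ 1)
    (ha : ∀ w : ℂ, w.re = 0 → ‖f w‖ ≤ a) (hb : ∀ w : ℂ, w.re = 1 → ‖f w‖ ≤ b) :
    ‖f x‖ ≤ a ^ (1 - x) * b ^ x := by
  obtain ⟨hd, M, hM⟩ := hf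
  have := Complex.HadamardThreeLines.norm_le_interp_of_mem_verticalClosedStrip₀₁' f
    (z := (x : ℂ)) (a := a) (b := b) (by simpa [Complex.HadamardThreeLines.verticalClosedStrip]
      using ⟨h0, h1⟩) hd.diffContOnCl
    ⟨M, by rintro _ ⟨w, hw, rfl⟩; exact hM w hw.1 hw.2⟩ ha hb
  simpa using this

end StripBounded

section UnitaryDiagonal

variable {n : Type*} [Fintype n] [DecidableEq n]

/-- The matrix with eigenvector matrix `U` and eigenvalues `f`. -/
def unitaryDiag (U : Matrix.unitaryGroup n ℂ) (f : n → ℂ) : Matrix n n ℂ :=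
  (U : Matrix n n ℂ) * Matrix.diagonal f * star (U : Matrix n n ℂ)

theorem unitaryDiag_mul (U : Matrix.unitaryGroup n ℂ) (f g : n → ℂ) :
    unitaryDiag U f * unitaryDiag U g = unitaryDiag U fun i => f i * g i := by
  have hU : star (U : Matrix n n ℂ) * (U : Matrix n n ℂ) = 1 := Unitary.coe_star_mul_self U
  unfold unitaryDiag
  rw [← Matrix.diagonal_mul_diagonal]
  calc _ = (U : Matrix n n ℂ) * Matrix.diagonal f * (star (U : Matrix n n ℂ) * U) *
        Matrix.diagonal g * star (U : Matrix n n ℂ) := by simp only [Matrix.mul_assoc]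
    _ = _ := by rw [hU]; simp only [Matrix.mul_assoc, Matrix.one_mul]

theorem unitaryDiag_conjTranspose (U : Matrix.unitaryGroup n ℂ) (f : n → ℂ) :
    (unitaryDiag U f)ᴴ = unitaryDiag U (star f) := by
  simp [unitaryDiag, Matrix.star_eq_conjTranspose, Matrix.mul_assoc]

theorem trace_unitaryDiag (U : Matrix.unitaryGroup n ℂ) (f : n → ℂ) :
    (unitaryDiag U f).trace = ∑ i, f i := by
  have hU : star (U : Matrix n n ℂ) * (U : Matrix n n ℂ) = 1 := Unitary.coe_star_mul_self U
  rw [unitaryDiag, Matrix.trace_mul_comm, ← Matrix.mul_assoc, hU, Matrix.one_mul,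
    Matrix.trace_diagonal]

theorem norm_unitary_le_one (U : Matrix.unitaryGroup n ℂ) : ‖(U : Matrix n n ℂ)‖ ≤ 1 :=
  by
  rcases isEmpty_or_nonempty n with h | h
  · simp [Subsingleton.elim (U : Matrix n n ℂ) 0]
  · exact (CStarRing.norm_coe_unitary U).le

theorem norm_matrix_mul_le_one {A B : Matrix n n ℂ} (hA : ‖A‖ ≤ 1) (hB : ‖B‖ ≤ 1) :
    ‖A * B‖ ≤ 1 :=
  (norm_mul_le A B).trans (mul_le_one₀ hA (norm_nonneg _) hB)

theorem norm_unitaryDiag_le_one (U : Matrix.unitaryGroup n ℂ) {f : n → ℂ}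
    (hf : ∀ i, ‖f i‖ ≤ 1) : ‖unitaryDiag U f‖ ≤ 1 := by
  refine norm_matrix_mul_le_one (norm_matrix_mul_le_one (norm_unitary_le_one U) ?_) ?_
  · rw [Matrix.l2_opNorm_diagonal]
    exact (pi_norm_le_iff_of_nonneg zero_le_one).2 hf
  · rw [norm_star]
    exact norm_unitary_le_one U

theorem sum_sq_col_le_one {A : Matrix n n ℂ} (hA : ‖A‖ ≤ 1) (j : n) :
    ∑ i, ‖A i j‖ ^ 2 ≤ 1 := by
  have h := Matrix.l2_opNorm_mulVec A (EuclideanSpace.single j 1)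
  rw [PiLp.norm_single, norm_one, mul_one] at h
  have h2 := pow_le_one₀ (n := 2) (norm_nonneg _) (h.trans hA)
  rw [EuclideanSpace.norm_sq_eq] at h2
  simpa using h2

theorem sum_sq_row_le_one {A : Matrix n n ℂ} (hA : ‖A‖ ≤ 1) (i : n) :
    ∑ j, ‖A i j‖ ^ 2 ≤ 1 := by
  have h := sum_sq_col_le_one (A := Aᴴ) (by rwa [Matrix.l2_opNorm_conjTranspose]) i
  simpa using h

theorem norm_apply_le_one {A : Matrix n n ℂ} (hA : ‖A‖ ≤ 1) (i j : n) : ‖A i j‖ ≤ 1 := by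
  have h := sum_sq_col_le_one hA j
  have h2 := Finset.single_le_sum (f := fun i => ‖A i j‖ ^ 2) (fun _ _ => by positivity)
    (Finset.mem_univ i)
  exact (sq_le_one_iff₀ (norm_nonneg _)).1 (h2.trans h)

theorem eq_unitaryDiag_eigenvalues {A : Matrix n n ℂ} (h : A.IsHermitian) :
    A = unitaryDiag h.eigenvectorUnitary (fun i => (h.eigenvalues i : ℂ)) := by
  conv_lhs => rw [h.spectral_theorem]
  rfl

theorem mrpow_eq_unitaryDiag {A : Matrix n n ℂ} (h : A.PosSemidef) {r : ℝ} (hr : r ≠ 0) :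
    mrpow A r = unitaryDiag h.1.eigenvectorUnitary
      (fun i => suppCpow (h.1.eigenvalues i) r) := by
  rw [mrpow, dif_pos h.1]
  simp only [suppCpow_ofReal (h.eigenvalues_nonneg _) hr]
  rfl

/-- Polar decomposition with a contraction as the angular part. -/
theorem exists_polar (X : Matrix n n ℂ) (h : (Xᴴ * X).PosSemidef) :
    ∃ C : Matrix n n ℂ, ‖C‖ ≤ 1 ∧
      X = C * unitaryDiag h.1.eigenvectorUnitary (fun i => (√(h.1.eigenvalues i) : ℂ)) ∧
      Cᴴ * X = unitaryDiag h.1.eigenvectorUnitary (fun i => (√(h.1.eigenvalues i) : ℂ)) := by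
  set U := h.1.eigenvectorUnitary
  set e := h.1.eigenvalues
  have he : ∀ i, 0 ≤ e i := h.eigenvalues_nonneg
  have hE : Xᴴ * X = unitaryDiag U (fun i => (e i : ℂ)) := eq_unitaryDiag_eigenvalues h.1
  have hy : ∀ i, (√(e i))⁻¹ * e i = √(e i) := fun i => by
    rcases (he i).eq_or_lt with h0 | h0
    · simp [← h0]
    · have h1 := Real.mul_self_sqrt (he i)
      have h2 := (Real.sqrt_pos.2 h0).ne'
      field_simp
      nlinarith
  set Y := unitaryDiag U (fun i => (((√(e i))⁻¹ : ℝ) : ℂ)) with hY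
  have hYs : Yᴴ = Y := by
    rw [hY, unitaryDiag_conjTranspose]
    congr 1
    ext i
    simp
  have hYE : Y * (Xᴴ * X) = unitaryDiag U (fun i => (√(e i) : ℂ)) := by
    rw [hE, hY, unitaryDiag_mul]
    congr 1
    ext i
    rw [← Complex.ofReal_mul, hy i]
  refine ⟨X * Y, ?_, ?_, ?_⟩
  · have h1 : ‖(X * Y)ᴴ * (X * Y)‖ ≤ 1 := by
      rw [Matrix.conjTranspose_mul, hYs,
        show Y * Xᴴ * (X * Y) = Y * (Xᴴ * X) * Y by simp only [Matrix.mul_assoc], hYE, hY,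
        unitaryDiag_mul]
      refine norm_unitaryDiag_le_one U fun i => ?_
      rw [← Complex.ofReal_mul, Complex.norm_real, Real.norm_of_nonneg (by positivity)]
      exact mul_inv_le_one
    rw [Matrix.l2_opNorm_conjTranspose_mul_self] at h1
    nlinarith [norm_nonneg (X * Y)]
  · rw [Matrix.mul_assoc, hY, unitaryDiag_mul]
    set P := unitaryDiag U (fun i => (((√(e i))⁻¹ : ℝ) : ℂ) * (√(e i) : ℂ)) with hP
    have hPs : Pᴴ = P := by
      rw [hP, unitaryDiag_conjTranspose]
      congr 1
      ext i
      simp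
    have hEP : Xᴴ * X * P = Xᴴ * X := by
      rw [hE, hP, unitaryDiag_mul]
      congr 1
      ext i
      norm_cast
      rcases (he i).eq_or_lt with h0 | h0
      · simp [← h0]
      · rw [inv_mul_cancel₀ (Real.sqrt_pos.2 h0).ne', mul_one]
    have hPE : P * (Xᴴ * X) = Xᴴ * X := by
      have := congrArg Matrix.conjTranspose hEP
      simpa [Matrix.conjTranspose_mul, hPs] using this
    rw [← sub_eq_zero, ← Matrix.conjTranspose_mul_self_eq_zero, Matrix.conjTranspose_sub,
      Matrix.conjTranspose_mul, hPs]
    rw [Matrix.sub_mul, Matrix.mul_sub, Matrix.mul_sub, ← Matrix.mul_assoc Xᴴ X P, hEP,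
      Matrix.mul_assoc P, hPE, Matrix.mul_assoc P, ← Matrix.mul_assoc Xᴴ X P, hEP, hPE]
    simp
  · rw [Matrix.conjTranspose_mul, hYs, Matrix.mul_assoc, hYE]

/-- A trace Young inequality: diagonal matrices interlaced with contractions. -/
theorem norm_trace_diagonal_mul_le (q s : n → ℂ) {A B : Matrix n n ℂ} (hA : ‖A‖ ≤ 1)
    (hB : ‖B‖ ≤ 1) {Q S : n → ℝ} (hQ : ∀ i, 0 ≤ Q i) (hS : ∀ i, 0 ≤ S i)
    (hqs : ∀ i j, ‖q i‖ * ‖s j‖ ≤ Q i + S j) :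
    ‖(Matrix.diagonal q * A * Matrix.diagonal s * B).trace‖ ≤ ∑ i, Q i + ∑ j, S j := by
  have htr : (Matrix.diagonal q * A * Matrix.diagonal s * B).trace =
      ∑ i, ∑ j, q i * A i j * s j * B j i := by
    simp only [Matrix.trace, Matrix.diag_apply]
    refine Finset.sum_congr rfl fun i _ => ?_
    rw [Matrix.mul_apply]
    simp only [Matrix.diagonal_mul, Matrix.mul_diagonal]
  have hw : ∀ i j, ‖A i j‖ * ‖B j i‖ ≤ (‖A i j‖ ^ 2 + ‖B j i‖ ^ 2) / 2 := fun i j => by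
    nlinarith [sq_nonneg (‖A i j‖ - ‖B j i‖)]
  set W : n → n → ℝ := fun i j => (‖A i j‖ ^ 2 + ‖B j i‖ ^ 2) / 2 with hW
  have hrow : ∀ i, ∑ j, W i j ≤ 1 := fun i => by
    rw [← Finset.sum_div, Finset.sum_add_distrib]
    linarith [sum_sq_row_le_one hA i, sum_sq_col_le_one hB i]
  have hcol : ∀ j, ∑ i, W i j ≤ 1 := fun j => by
    rw [← Finset.sum_div, Finset.sum_add_distrib]
    linarith [sum_sq_row_le_one hB j, sum_sq_col_le_one hA j]
  rw [htr]
  calc ‖∑ i, ∑ j, q i * A i j * s j * B j i‖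
      ≤ ∑ i, ∑ j, ‖q i * A i j * s j * B j i‖ :=
        (norm_sum_le _ _).trans (Finset.sum_le_sum fun i _ => norm_sum_le _ _)
    _ ≤ ∑ i, ∑ j, (Q i * W i j + S j * W i j) := by
        refine Finset.sum_le_sum fun i _ => Finset.sum_le_sum fun j _ => ?_
        rw [norm_mul, norm_mul, norm_mul, ← add_mul]
        calc ‖q i‖ * ‖A i j‖ * ‖s j‖ * ‖B j i‖
            = (‖q i‖ * ‖s j‖) * (‖A i j‖ * ‖B j i‖) := by ring
          _ ≤ (Q i + S j) * W i j :=
            mul_le_mul (hqs i j) (hw i j) (by positivity) (add_nonneg (hQ i) (hS j))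
    _ = ∑ i, Q i * ∑ j, W i j + ∑ j, S j * ∑ i, W i j := by
        simp only [Finset.sum_add_distrib, Finset.mul_sum]
        congr 1
        exact Finset.sum_comm
    _ ≤ ∑ i, Q i + ∑ j, S j :=
        add_le_add
          (Finset.sum_le_sum fun i _ => mul_le_of_le_one_right (hQ i) (hrow i))
          (Finset.sum_le_sum fun j _ => mul_le_of_le_one_right (hS j) (hcol j))

/-- The complex power `s ↦ A ^ s` of the matrix with eigenvectors `U` and eigenvalues `r`,
supported on the range of `A`. -/
noncomputable def unitaryCpow (U : Matrix.unitaryGroup n ℂ) (r : n → ℝ) (s : ℂ) :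
    Matrix n n ℂ :=
  unitaryDiag U fun i => suppCpow (r i) s

theorem unitaryCpow_add (U : Matrix.unitaryGroup n ℂ) (r : n → ℝ) (s t : ℂ) :
    unitaryCpow U r (s + t) = unitaryCpow U r s * unitaryCpow U r t := by
  simp only [unitaryCpow, unitaryDiag_mul, suppCpow_add]

theorem unitaryCpow_conjTranspose (U : Matrix.unitaryGroup n ℂ) {r : n → ℝ} (hr : ∀ i, 0 ≤ r i)
    {s : ℝ} (hs : s ≠ 0) : (unitaryCpow U r s)ᴴ = unitaryCpow U r s := by
  rw [unitaryCpow, unitaryDiag_conjTranspose]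
  congr 1
  ext i
  simp only [Pi.star_apply]
  rw [suppCpow_ofReal (hr i) hs]
  simp

theorem norm_unitaryCpow_le_one (U : Matrix.unitaryGroup n ℂ) {r : n → ℝ} (hr : ∀ i, 0 ≤ r i)
    {s : ℂ} (hs : s.re = 0) : ‖unitaryCpow U r s‖ ≤ 1 :=
  norm_unitaryDiag_le_one U fun i => by simpa [hs] using norm_suppCpow_le (hr i) s

theorem unitaryCpow_stripBounded (U : Matrix.unitaryGroup n ℂ) {r : n → ℝ}
    (hr : ∀ i, 0 ≤ r i) (c k : ℝ) (i j : n) :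
    StripBounded fun w => unitaryCpow U r (c + k * w) i j :=
  StripBounded.matrix_mul
    (F := fun w => (U : Matrix n n ℂ) * Matrix.diagonal fun l => suppCpow (r l) (c + k * w))
    (G := fun _ => star (U : Matrix n n ℂ))
    (StripBounded.matrix_mul (F := fun _ => (U : Matrix n n ℂ))
      (G := fun w => Matrix.diagonal fun l => suppCpow (r l) (c + k * w))
      (fun _ _ => StripBounded.const _)
      (StripBounded.diagonal (f := fun l w => suppCpow (r l) (c + k * w))
        fun l => StripBounded.suppCpow (hr l) c k))
    (fun _ _ => StripBounded.const _) i j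

/-- The Araki–Lieb–Thirring inequality `tr (B^{z/2} A^z B^{z/2}) ≤ tr (B^{1/2} A B^{1/2})^z`
for `1/2 ≤ z ≤ 1`, where `K = A^{1/2} B^{1/2}` and `X = A^{z/2} B^{z/2}`. -/
theorem araki_lieb_thirring (U V : Matrix.unitaryGroup n ℂ) {r t : n → ℝ}
    (hr : ∀ i, 0 ≤ r i) (ht : ∀ i, 0 ≤ t i) (a b z : ℝ)
    (hz : 1 / 2 ≤ z) (hz1 : z ≤ 1) {K X : Matrix n n ℂ}
    (hK : K = unitaryCpow U r (a / 2 : ℝ) * unitaryCpow V t (b / 2 : ℝ))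
    (hX : X = unitaryCpow U r (a / 2 * z : ℝ) * unitaryCpow V t (b / 2 * z : ℝ))
    (hKK : (Kᴴ * K).PosSemidef) (hXX : (Xᴴ * X).PosSemidef) :
    ∑ i, hXX.1.eigenvalues i ≤ ∑ i, hKK.1.eigenvalues i ^ z := by
  have hz0 : 0 < z := by linarith
  obtain ⟨C, hC, -, hCX⟩ := exists_polar X hXX
  obtain ⟨C', hC', hKC, -⟩ := exists_polar K hKK
  set E := hXX.1.eigenvectorUnitary
  set e := hXX.1.eigenvalues
  set D := hKK.1.eigenvectorUnitary
  set d := hKK.1.eigenvalues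
  have he : ∀ i, 0 ≤ e i := hXX.eigenvalues_nonneg
  have hd : ∀ i, 0 ≤ d i := hKK.eigenvalues_nonneg
  set T := ∑ i, e i with hT
  set M := ∑ i, d i ^ z with hM
  have hT0 : 0 ≤ T := Finset.sum_nonneg fun i _ => he i
  have hM0 : 0 ≤ M := Finset.sum_nonneg fun i _ => Real.rpow_nonneg (hd i) _
  have hCs : ‖Cᴴ‖ ≤ 1 := by rwa [Matrix.l2_opNorm_conjTranspose]
  have hEs : ‖star (E : Matrix n n ℂ)‖ ≤ 1 := by
    rw [norm_star]; exact norm_unitary_le_one E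
  have hDs : ‖star (D : Matrix n n ℂ)‖ ≤ 1 := by
    rw [norm_star]; exact norm_unitary_le_one D
  set ω : ℝ := 1 / (2 * z) with hω
  have hω0 : 0 ≤ ω := by positivity
  have hω1 : ω ≤ 1 := by
    rw [hω, div_le_one (by positivity)]
    linarith
  have hωz : z * ω = 1 / 2 := by rw [hω]; field_simp
  set G : ℂ → Matrix n n ℂ := fun w =>
    unitaryCpow E e ((1 : ℝ) + (-ω : ℝ) * w) * Cᴴ *
      unitaryCpow U r ((0 : ℝ) + (a / 2 : ℝ) * w) *
      unitaryCpow V t ((0 : ℝ) + (b / 2 : ℝ) * w) with hG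
  have hF : StripBounded fun w => (G w).trace := by
    set G₁ : ℂ → Matrix n n ℂ := fun w => unitaryCpow E e ((1 : ℝ) + (-ω : ℝ) * w)
    set G₂ : ℂ → Matrix n n ℂ := fun w => unitaryCpow U r ((0 : ℝ) + (a / 2 : ℝ) * w)
    set G₃ : ℂ → Matrix n n ℂ := fun w => unitaryCpow V t ((0 : ℝ) + (b / 2 : ℝ) * w)
    have h₁ : ∀ i j, StripBounded fun w => G₁ w i j := unitaryCpow_stripBounded E he _ _
    have h₂ : ∀ i j, StripBounded fun w => G₂ w i j := unitaryCpow_stripBounded U hr _ _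
    have h₃ : ∀ i j, StripBounded fun w => G₃ w i j := unitaryCpow_stripBounded V ht _ _
    have h₄ : ∀ i j, StripBounded fun w => (G₁ w * Cᴴ) i j :=
      StripBounded.matrix_mul (G := fun _ => Cᴴ) h₁ fun _ _ => StripBounded.const _
    have h₅ : ∀ i j, StripBounded fun w => (G₁ w * Cᴴ * G₂ w) i j :=
      StripBounded.matrix_mul h₄ h₂
    have h₆ : ∀ i j, StripBounded fun w => G w i j := StripBounded.matrix_mul h₅ h₃
    exact StripBounded.sum (f := fun i w => G w i i) Finset.univ fun i => h₆ i i
  have h0 : ∀ w : ℂ, w.re = 0 → ‖(G w).trace‖ ≤ T := by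
    intro w hw
    set R := star (E : Matrix n n ℂ) * Cᴴ * unitaryCpow U r ((0 : ℝ) + (a / 2 : ℝ) * w) *
      unitaryCpow V t ((0 : ℝ) + (b / 2 : ℝ) * w) * E with hR
    have hR1 : ‖R‖ ≤ 1 :=
      norm_matrix_mul_le_one (norm_matrix_mul_le_one (norm_matrix_mul_le_one
        (norm_matrix_mul_le_one hEs hCs) (norm_unitaryCpow_le_one U hr (by simp [hw])))
        (norm_unitaryCpow_le_one V ht (by simp [hw]))) (norm_unitary_le_one E)
    have htr : (G w).trace =
        (Matrix.diagonal (fun i => suppCpow (e i) ((1 : ℝ) + (-ω : ℝ) * w)) * R).trace := by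
      simp only [hG, hR, unitaryCpow, unitaryDiag, Matrix.mul_assoc]
      rw [Matrix.trace_mul_comm]
      simp only [Matrix.mul_assoc]
    rw [htr, Matrix.trace]
    refine (norm_sum_le _ _).trans (Finset.sum_le_sum fun i _ => ?_)
    rw [Matrix.diag_apply, Matrix.diagonal_mul, norm_mul]
    have h1 := norm_suppCpow_le (he i) ((1 : ℝ) + (-ω : ℝ) * w)
    have h2 : ((1 : ℝ) + (-ω : ℝ) * w : ℂ).re = 1 := by simp [hw]
    rw [h2, Real.rpow_one] at h1
    exact (mul_le_mul h1 (norm_apply_le_one hR1 i i) (norm_nonneg _) (he i)).trans_eq (mul_one _)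
  have h1 : ∀ w : ℂ, w.re = 1 → ‖(G w).trace‖ ≤ (1 - ω) * T + ω * M := by
    intro w hw
    have hGK : G w = unitaryCpow E e ((1 : ℝ) + (-ω : ℝ) * w) * Cᴴ *
        unitaryCpow U r ((a / 2 : ℝ) * (w - 1)) * K *
        unitaryCpow V t ((b / 2 : ℝ) * (w - 1)) := by
      have hu : ((0 : ℝ) + (a / 2 : ℝ) * w : ℂ) = (a / 2 : ℝ) * (w - 1) + (a / 2 : ℝ) := by
        push_cast; ring
      have hv : ((0 : ℝ) + (b / 2 : ℝ) * w : ℂ) = (b / 2 : ℝ) + (b / 2 : ℝ) * (w - 1) := by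
        push_cast; ring
      simp only [hG, hK]
      rw [hu, hv, unitaryCpow_add U, unitaryCpow_add V]
      simp only [Matrix.mul_assoc]
    set R := star (E : Matrix n n ℂ) * Cᴴ * unitaryCpow U r ((a / 2 : ℝ) * (w - 1)) * C' * D
      with hR
    set S := star (D : Matrix n n ℂ) * unitaryCpow V t ((b / 2 : ℝ) * (w - 1)) * E with hS
    have hR1 : ‖R‖ ≤ 1 :=
      norm_matrix_mul_le_one (norm_matrix_mul_le_one (norm_matrix_mul_le_one
        (norm_matrix_mul_le_one hEs hCs) (norm_unitaryCpow_le_one U hr (by simp [hw])))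
        hC') (norm_unitary_le_one D)
    have hS1 : ‖S‖ ≤ 1 :=
      norm_matrix_mul_le_one (norm_matrix_mul_le_one hDs
        (norm_unitaryCpow_le_one V ht (by simp [hw]))) (norm_unitary_le_one E)
    have htr : (G w).trace =
        (Matrix.diagonal (fun i => suppCpow (e i) ((1 : ℝ) + (-ω : ℝ) * w)) * R *
          Matrix.diagonal (fun i => (√(d i) : ℂ)) * S).trace := by
      rw [hGK, hKC]
      simp only [hR, hS, unitaryCpow, unitaryDiag, Matrix.mul_assoc]
      rw [Matrix.trace_mul_comm]
      simp only [Matrix.mul_assoc]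
    rw [htr, hT, hM, Finset.mul_sum, Finset.mul_sum]
    refine norm_trace_diagonal_mul_le _ _ hR1 hS1
      (fun i => mul_nonneg (by linarith) (he i))
      (fun i => mul_nonneg hω0 (Real.rpow_nonneg (hd i) _)) fun i j => ?_
    have h2 := norm_suppCpow_le (he i) ((1 : ℝ) + (-ω : ℝ) * w)
    have h3 : ((1 : ℝ) + (-ω : ℝ) * w : ℂ).re = 1 - ω := by simp [hw]; ring
    rw [h3] at h2
    have h4 : ‖(√(d j) : ℂ)‖ = (d j ^ z) ^ ω := by
      rw [Complex.norm_real, Real.norm_of_nonneg (Real.sqrt_nonneg _), ← Real.rpow_mul (hd j),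
        hωz, Real.sqrt_eq_rpow]
    rw [h4]
    exact (mul_le_mul_of_nonneg_right h2 (by have := hd j; positivity)).trans
      (Real.geom_mean_le_arith_mean2_weighted (by linarith) hω0 (he i)
        (Real.rpow_nonneg (hd j) _) (by ring))
  have hval : (G z).trace = (T : ℂ) := by
    have h2 : ((1 : ℝ) + (-ω : ℝ) * (z : ℂ)) = ((1 / 2 : ℝ) : ℂ) := by
      rw [← Complex.ofReal_mul, ← Complex.ofReal_add]
      congr 1
      linarith
    have h3 : G z = unitaryCpow E e (1 / 2 : ℝ) * (Cᴴ * X) := by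
      simp only [hG, hX]
      rw [h2]
      simp only [Complex.ofReal_zero, zero_add, ← Complex.ofReal_mul, Matrix.mul_assoc]
    rw [h3, hCX, unitaryCpow, unitaryDiag_mul, trace_unitaryDiag, hT]
    push_cast
    refine Finset.sum_congr rfl fun i _ => ?_
    have h4 := suppCpow_ofReal (he i) (r := 1 / 2) (by norm_num)
    push_cast at h4
    rw [h4, ← Real.sqrt_eq_rpow]
    norm_cast
    exact Real.mul_self_sqrt (he i)
  have h3l := hF.three_lines hz0.le hz1 h0 h1
  rw [hval, Complex.norm_real, Real.norm_of_nonneg hT0] at h3l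
  by_contra hlt
  push Not at hlt
  have hTpos : 0 < T := hM0.trans_lt hlt
  have hωpos : 0 < ω := by positivity
  have hN : (1 - ω) * T + ω * M < T := by nlinarith
  have hN0 : 0 ≤ (1 - ω) * T + ω * M :=
    add_nonneg (mul_nonneg (by linarith) hT0) (mul_nonneg hω0 hM0)
  have h5 := mul_lt_mul_of_pos_left (Real.rpow_lt_rpow hN0 hN hz0)
    (Real.rpow_pos_of_pos hTpos (1 - z))
  rw [← Real.rpow_add hTpos, sub_add_cancel, Real.rpow_one] at h5
  linarith

theorem conjM_posSemidef {A : Matrix n n ℂ} (h : A.PosSemidef) : (conjM A).PosSemidef := by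
  have h2 : conjM A = Aᵀ := by
    rw [← congrArg Matrix.transpose h.1.eq]
    ext i j
    simp [conjM]
  rw [h2]
  exact h.transpose

theorem trace_mrpow_mul_le_fRenyi {ρ σ : Matrix n n ℂ} (hρ : ρ.PosSemidef) (hσ : σ.PosSemidef)
    {α z : ℝ} (hα : 0 < α) (hα1 : α < 1) (hz : 1 / 2 ≤ z) (hz1 : z ≤ 1) :
    (mrpow ρ α * mrpow σ (1 - α)).trace ≤ fRenyi α z ρ σ := by
  have hz0 : 0 < z := by linarith
  have hβ : 0 < 1 - α := by linarith
  set U := hρ.1.eigenvectorUnitary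
  set r := hρ.1.eigenvalues
  set V := hσ.1.eigenvectorUnitary
  set t := hσ.1.eigenvalues
  have hr0 : ∀ i, 0 ≤ r i := hρ.eigenvalues_nonneg
  have ht0 : ∀ i, 0 ≤ t i := hσ.eigenvalues_nonneg
  set a := α / z with ha
  set b := (1 - α) / z with hb
  have ha0 : 0 < a := by positivity
  have hb0 : 0 < b := by positivity
  have hρpow : ∀ {s : ℝ}, s ≠ 0 → mrpow ρ s = unitaryCpow U r s := mrpow_eq_unitaryDiag hρ
  have hσpow : ∀ {s : ℝ}, s ≠ 0 → mrpow σ s = unitaryCpow V t s := mrpow_eq_unitaryDiag hσ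
  have hadd : ∀ (W : Matrix.unitaryGroup n ℂ) (x : n → ℝ) (s : ℝ),
      unitaryCpow W x (s / 2 : ℝ) * unitaryCpow W x (s / 2 : ℝ) = unitaryCpow W x s := by
    intro W x s
    rw [← unitaryCpow_add]
    congr 1
    push_cast
    ring
  set K := unitaryCpow U r (a / 2 : ℝ) * unitaryCpow V t (b / 2 : ℝ) with hK
  set X := unitaryCpow U r (a / 2 * z : ℝ) * unitaryCpow V t (b / 2 * z : ℝ) with hX
  have hKK := Matrix.posSemidef_conjTranspose_mul_self K
  have hXX := Matrix.posSemidef_conjTranspose_mul_self X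
  have hKe : Kᴴ * K =
      mrpow σ ((1 - α) / (2 * z)) * mrpow ρ (α / z) * mrpow σ ((1 - α) / (2 * z)) := by
    have hb2 : (1 - α) / (2 * z) = b / 2 := by rw [hb]; field_simp
    rw [hb2, hσpow (by positivity), hρpow (by positivity), hK, Matrix.conjTranspose_mul,
      unitaryCpow_conjTranspose V ht0 (by positivity),
      unitaryCpow_conjTranspose U hr0 (by positivity), ← hadd U r (α / z)]
    simp only [← ha, Matrix.mul_assoc]
  have hL : (mrpow ρ α * mrpow σ (1 - α)).trace = ((∑ i, hXX.1.eigenvalues i : ℝ) : ℂ) := by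
    have ha2 : a / 2 * z = α / 2 := by rw [ha]; field_simp
    have hb2 : b / 2 * z = (1 - α) / 2 := by rw [hb]; field_simp
    have htr : (Xᴴ * X).trace = ((∑ i, hXX.1.eigenvalues i : ℝ) : ℂ) := by
      rw [hXX.1.trace_eq_sum_eigenvalues]
      push_cast
      rfl
    rw [← htr, hX, ha2, hb2, hρpow hα.ne', hσpow hβ.ne', Matrix.conjTranspose_mul,
      unitaryCpow_conjTranspose V ht0 (by positivity),
      unitaryCpow_conjTranspose U hr0 (by positivity), ← hadd U r α, ← hadd V t (1 - α),
      Matrix.trace_mul_comm, Matrix.mul_assoc, Matrix.trace_mul_comm]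
    simp only [Matrix.mul_assoc]
  have hR : fRenyi α z ρ σ = ((∑ i, hKK.1.eigenvalues i ^ z : ℝ) : ℂ) := by
    rw [fRenyi, ← hKe, mrpow_eq_unitaryDiag hKK hz0.ne', trace_unitaryDiag]
    push_cast
    exact Finset.sum_congr rfl fun i _ => suppCpow_ofReal (hKK.eigenvalues_nonneg i) hz0.ne'
  rw [hL, hR]
  exact_mod_cast araki_lieb_thirring U V hr0 ht0 a b z hz hz1 hK hX hKK hXX

end UnitaryDiagonal

theorem stmt15 {n : Type*} [Fintype n] [DecidableEq n] (ρ : Matrix n n ℂ)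
    (hρ : ρ.PosSemidef) (htr : ρ.trace = 1)
    (α z : ℝ) (h0 : 0 < max α (1 - α)) (hz : max α (1 - α) ≤ z) (hz1 : z < 1) :
    (mrpow ρ α * mrpow (conjM ρ) (1 - α)).trace ≤ fRenyi α z ρ (conjM ρ) ∧
      1 - fRenyi α z ρ (conjM ρ) ≤ 1 - (mrpow ρ α * mrpow (conjM ρ) (1 - α)).trace := by
  have hα := (le_max_left α (1 - α)).trans hz
  have hβ := (le_max_right α (1 - α)).trans hz
  have h := trace_mrpow_mul_le_fRenyi hρ (conjM_posSemidef hρ) (α := α) (z := z)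
    (by linarith) (by linarith) (by linarith) hz1.le
  exact ⟨h, sub_le_sub_left h 1⟩
end

section
/- The measure M^O_λ is additive on block-diagonal mixtures: for positive definite density matrices δ₁, δ₂ and weights d₁, d₂ > 0 with d₁ + d₂ = 1, Tr[(d₁δ₁ ⊕ d₂δ₂) ♯_λ (d₁δ₁* ⊕ d₂δ₂*)] = d₁Tr[δ₁ ♯_λ δ₁*] + d₂Tr[δ₂ ♯_λ δ₂*], hence M^O_λ(d₁δ₁ ⊕ d₂δ₂) = d₁M^O_λ(δ₁) + d₂M^O_λ(δ₂). -/
open Matrix ComplexOrder Kronecker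

theorem Matrix.IsHermitian.eq_conj_diagonal {n : Type*} [Fintype n] [DecidableEq n]
    {A : Matrix n n ℂ} (h : A.IsHermitian) :
    A = (h.eigenvectorUnitary : Matrix n n ℂ) * diagonal (fun i => (h.eigenvalues i : ℂ)) *
      star (h.eigenvectorUnitary : Matrix n n ℂ) := by
  conv_lhs => rw [h.spectral_theorem]
  rfl

theorem Matrix.IsHermitian.exists_unitary_diagonal {n : Type*} [Fintype n] [DecidableEq n]
    {A : Matrix n n ℂ} (h : A.IsHermitian) :
    ∃ U : Matrix n n ℂ, star U * U = 1 ∧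
      A = U * diagonal (fun i => (h.eigenvalues i : ℂ)) * star U :=
  ⟨_, Unitary.coe_star_mul_self h.eigenvectorUnitary, h.eq_conj_diagonal⟩

/-- The real power of a Hermitian matrix can be computed from any unitary diagonalization. -/
theorem mrpow_conj_diagonal {n : Type*} [Fintype n] [DecidableEq n]
    {U : Matrix n n ℂ} (hU : star U * U = 1) (f : n → ℝ) (r : ℝ) :
    mrpow (U * diagonal (fun i => (f i : ℂ)) * star U) r =
      U * diagonal (fun i => ((f i ^ r : ℝ) : ℂ)) * star U := by
  set A := U * diagonal (fun i => (f i : ℂ)) * star U with hA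
  have hU' : U * star U = 1 := mul_eq_one_comm.mp hU
  have h : A.IsHermitian := by
    refine isHermitian_mul_mul_conjTranspose U (isHermitian_diagonal_of_self_adjoint _ ?_)
    ext i
    simp
  rw [mrpow, dif_pos h]
  set V := (h.eigenvectorUnitary : Matrix n n ℂ)
  have hV : star V * V = 1 := Unitary.coe_star_mul_self h.eigenvectorUnitary
  have hV' : V * star V = 1 := mul_eq_one_comm.mp hV
  have hspec : A = V * diagonal (fun i => (h.eigenvalues i : ℂ)) * star V :=
    h.eq_conj_diagonal
  generalize h.eigenvalues = g at hspec ⊢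
  have hcomm : diagonal (fun i => (g i : ℂ)) * (star V * U) =
      (star V * U) * diagonal (fun i => (f i : ℂ)) := by
    calc _ = star V * V * diagonal (fun i => (g i : ℂ)) * star V * U := by
          rw [hV, one_mul, mul_assoc]
      _ = star V * A * U := by rw [hspec]; simp only [mul_assoc]
      _ = star V * U * diagonal (fun i => (f i : ℂ)) * (star U * U) := by
          rw [hA]; simp only [mul_assoc]
      _ = _ := by rw [hU, mul_one]
  have hpow : diagonal (fun i => ((g i ^ r : ℝ) : ℂ)) * (star V * U) =
      (star V * U) * diagonal (fun i => ((f i ^ r : ℝ) : ℂ)) := by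
    ext i j
    have hij := congrFun (congrFun hcomm i) j
    rw [diagonal_mul, mul_diagonal] at hij ⊢
    rw [mul_comm] at hij
    rcases mul_eq_mul_left_iff.mp hij with h₁ | h₁
    · rw [Complex.ofReal_inj.mp h₁, mul_comm]
    · simp [h₁]
  calc _ = V * (diagonal (fun i => ((g i ^ r : ℝ) : ℂ)) * (star V * U)) * star U := by
        simp only [mul_assoc, hU', mul_one]
    _ = (V * star V) * U * diagonal (fun i => ((f i ^ r : ℝ) : ℂ)) * star U := by
        rw [hpow]; simp only [mul_assoc]
    _ = _ := by rw [hV', one_mul]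

theorem mrpow_isHermitian {n : Type*} [Fintype n] [DecidableEq n]
    (A : Matrix n n ℂ) (r : ℝ) : (mrpow A r).IsHermitian := by
  unfold mrpow
  split_ifs with h
  · refine isHermitian_mul_mul_conjTranspose _ (isHermitian_diagonal_of_self_adjoint _ ?_)
    ext i
    simp
  · exact isHermitian_zero

theorem mrpow_mul_mul_mrpow_isHermitian {n : Type*} [Fintype n] [DecidableEq n]
    {B : Matrix n n ℂ} (hB : B.IsHermitian) (A : Matrix n n ℂ) (r : ℝ) :
    (mrpow A r * B * mrpow A r).IsHermitian := by
  simpa only [(mrpow_isHermitian A r).eq] using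
    isHermitian_mul_mul_conjTranspose (mrpow A r) hB

theorem mrpow_smul {n : Type*} [Fintype n] [DecidableEq n]
    {A : Matrix n n ℂ} (hA : A.PosSemidef) {c : ℝ} (hc : 0 ≤ c) (r : ℝ) :
    mrpow ((c : ℂ) • A) r = ((c ^ r : ℝ) : ℂ) • mrpow A r := by
  obtain ⟨U, hU, hUA⟩ := hA.isHermitian.exists_unitary_diagonal
  have hf := hA.eigenvalues_nonneg
  generalize hA.isHermitian.eigenvalues = f at hUA hf
  have hsmul (s : ℝ) (g : n → ℝ) : (s : ℂ) • (U * diagonal (fun i => (g i : ℂ)) * star U) =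
      U * diagonal (fun i => ((s * g i : ℝ) : ℂ)) * star U := by
    rw [← smul_mul_assoc, ← mul_smul_comm, ← diagonal_smul]
    congr 3
    ext i
    simp
  rw [hUA, hsmul, mrpow_conj_diagonal hU, mrpow_conj_diagonal hU, hsmul]
  simp only [Real.mul_rpow hc (hf _)]

theorem mrpow_fromBlocks {n m : Type*} [Fintype n] [DecidableEq n] [Fintype m] [DecidableEq m]
    {A : Matrix n n ℂ} {B : Matrix m m ℂ} (hA : A.IsHermitian) (hB : B.IsHermitian) (r : ℝ) :
    mrpow (fromBlocks A 0 0 B) r = fromBlocks (mrpow A r) 0 0 (mrpow B r) := by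
  obtain ⟨U, hU, hUA⟩ := hA.exists_unitary_diagonal
  obtain ⟨V, hV, hVB⟩ := hB.exists_unitary_diagonal
  generalize hA.eigenvalues = f at hUA
  generalize hB.eigenvalues = g at hVB
  have hblock (f : n → ℝ) (g : m → ℝ) :
      fromBlocks (U * diagonal (fun i => (f i : ℂ)) * star U) 0 0
        (V * diagonal (fun i => (g i : ℂ)) * star V) =
      fromBlocks U 0 0 V * diagonal (fun i => ((Sum.elim f g i : ℝ) : ℂ)) *
        star (fromBlocks U 0 0 V) := by
    have hd : diagonal (fun i => ((Sum.elim f g i : ℝ) : ℂ)) =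
        fromBlocks (diagonal fun i => (f i : ℂ)) 0 0 (diagonal fun i => (g i : ℂ)) := by
      rw [fromBlocks_diagonal]
      congr 1
      ext (i | i) <;> rfl
    rw [hd]
    simp [-fromBlocks_diagonal, star_eq_conjTranspose, fromBlocks_conjTranspose,
      fromBlocks_multiply]
  have hUV : star (fromBlocks U 0 0 V) * fromBlocks U 0 0 V = 1 := by
    rw [star_eq_conjTranspose] at hU hV ⊢
    simp [fromBlocks_conjTranspose, fromBlocks_multiply, hU, hV]
  rw [hUA, hVB, hblock, mrpow_conj_diagonal hUV, mrpow_conj_diagonal hU,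
    mrpow_conj_diagonal hV, hblock]
  congr 3
  ext (i | i) <;> rfl

theorem conjM_isHermitian {n : Type*} [Fintype n] [DecidableEq n]
    {A : Matrix n n ℂ} (hA : A.IsHermitian) : (conjM A).IsHermitian :=
  hA.map _ fun _ => rfl

theorem conjM_smul_ofReal {n : Type*} [Fintype n] [DecidableEq n]
    (c : ℝ) (A : Matrix n n ℂ) : conjM ((c : ℂ) • A) = (c : ℂ) • conjM A := by
  ext i j
  simp [conjM]

theorem conjM_fromBlocks {n m : Type*} [Fintype n] [DecidableEq n] [Fintype m] [DecidableEq m]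
    (A : Matrix n n ℂ) (B : Matrix m m ℂ) :
    conjM (fromBlocks A 0 0 B) = fromBlocks (conjM A) 0 0 (conjM B) := by
  simp [conjM, fromBlocks_map]

theorem Matrix.trace_fromBlocks {n m : Type*} [Fintype n] [Fintype m]
    {R : Type*} [AddCommMonoid R] (A : Matrix n n R) (B : Matrix n m R) (C : Matrix m n R)
    (D : Matrix m m R) : (fromBlocks A B C D).trace = A.trace + D.trace := by
  simp [trace]

theorem geomMean_smul {n : Type*} [Fintype n] [DecidableEq n]
    {A : Matrix n n ℂ} (hA : A.PosSemidef) (B : Matrix n n ℂ) {c : ℝ} (hc : 0 < c) (l : ℝ) :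
    geomMean ((c : ℂ) • A) ((c : ℂ) • B) l = (c : ℂ) • geomMean A B l := by
  have h₁ : ((c ^ (1 / 2 : ℝ) : ℝ) : ℂ) * ((c ^ (1 / 2 : ℝ) : ℝ) : ℂ) = c := by
    rw [← Complex.ofReal_mul, ← Real.rpow_add hc]
    norm_num
  have h₂ : ((c ^ (-(1 / 2) : ℝ) : ℝ) : ℂ) * (c * ((c ^ (-(1 / 2) : ℝ) : ℝ) : ℂ)) = 1 := by
    rw [mul_left_comm, ← Complex.ofReal_mul, ← Real.rpow_add hc, ← Complex.ofReal_mul]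
    norm_num [Real.rpow_neg_one, hc.ne']
  simp only [geomMean, mrpow_smul hA hc.le, smul_mul_assoc, mul_smul_comm, smul_smul, mul_assoc,
    h₁, h₂, one_smul]

theorem geomMean_fromBlocks {n m : Type*} [Fintype n] [DecidableEq n] [Fintype m] [DecidableEq m]
    {A₁ B₁ : Matrix n n ℂ} {A₂ B₂ : Matrix m m ℂ} (hA₁ : A₁.IsHermitian) (hB₁ : B₁.IsHermitian)
    (hA₂ : A₂.IsHermitian) (hB₂ : B₂.IsHermitian) (l : ℝ) :
    geomMean (fromBlocks A₁ 0 0 A₂) (fromBlocks B₁ 0 0 B₂) l =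
      fromBlocks (geomMean A₁ B₁ l) 0 0 (geomMean A₂ B₂ l) := by
  simp only [geomMean, mrpow_fromBlocks hA₁ hA₂, fromBlocks_multiply, Matrix.mul_zero,
    Matrix.zero_mul, add_zero, zero_add]
  rw [mrpow_fromBlocks (mrpow_mul_mul_mrpow_isHermitian hB₁ _ _)
    (mrpow_mul_mul_mrpow_isHermitian hB₂ _ _)]
  simp [fromBlocks_multiply]


theorem stmt19 {n m : Type*} [Fintype n] [DecidableEq n] [Fintype m] [DecidableEq m]
    (δ₁ : Matrix n n ℂ) (δ₂ : Matrix m m ℂ)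
    (hδ₁ : δ₁.PosDef) (htr₁ : δ₁.trace = 1)
    (hδ₂ : δ₂.PosDef) (htr₂ : δ₂.trace = 1)
    (d₁ d₂ : ℝ) (hd₁ : 0 < d₁) (hd₂ : 0 < d₂) (hd : d₁ + d₂ = 1)
    (l : ℝ) (hl0 : 0 < l) (hl1 : l < 1) :
    (geomMean (Matrix.fromBlocks (((d₁ : ℝ) : ℂ) • δ₁) 0 0 (((d₂ : ℝ) : ℂ) • δ₂))
        (Matrix.fromBlocks (((d₁ : ℝ) : ℂ) • conjM δ₁) 0 0 (((d₂ : ℝ) : ℂ) • conjM δ₂)) l).trace =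
      ((d₁ : ℝ) : ℂ) * (geomMean δ₁ (conjM δ₁) l).trace +
        ((d₂ : ℝ) : ℂ) * (geomMean δ₂ (conjM δ₂) l).trace ∧
    1 - (geomMean (Matrix.fromBlocks (((d₁ : ℝ) : ℂ) • δ₁) 0 0 (((d₂ : ℝ) : ℂ) • δ₂))
        (conjM (Matrix.fromBlocks (((d₁ : ℝ) : ℂ) • δ₁) 0 0 (((d₂ : ℝ) : ℂ) • δ₂))) l).trace =
      ((d₁ : ℝ) : ℂ) * (1 - (geomMean δ₁ (conjM δ₁) l).trace) +
        ((d₂ : ℝ) : ℂ) * (1 - (geomMean δ₂ (conjM δ₂) l).trace) := by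
  have hreal (c : ℝ) : IsSelfAdjoint (c : ℂ) := Complex.conj_ofReal c
  have key : (geomMean (Matrix.fromBlocks (((d₁ : ℝ) : ℂ) • δ₁) 0 0 (((d₂ : ℝ) : ℂ) • δ₂))
        (Matrix.fromBlocks (((d₁ : ℝ) : ℂ) • conjM δ₁) 0 0 (((d₂ : ℝ) : ℂ) • conjM δ₂)) l).trace =
      ((d₁ : ℝ) : ℂ) * (geomMean δ₁ (conjM δ₁) l).trace +
        ((d₂ : ℝ) : ℂ) * (geomMean δ₂ (conjM δ₂) l).trace := by
    rw [geomMean_fromBlocks (hδ₁.isHermitian.smul (hreal d₁))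
        ((conjM_isHermitian hδ₁.isHermitian).smul (hreal d₁))
        (hδ₂.isHermitian.smul (hreal d₂)) ((conjM_isHermitian hδ₂.isHermitian).smul (hreal d₂)),
      geomMean_smul hδ₁.posSemidef _ hd₁, geomMean_smul hδ₂.posSemidef _ hd₂,
      trace_fromBlocks, trace_smul, trace_smul, smul_eq_mul, smul_eq_mul]
  refine ⟨key, ?_⟩
  have hd' : (d₁ : ℂ) + d₂ = 1 := by exact_mod_cast hd
  rw [conjM_fromBlocks, conjM_smul_ofReal, conjM_smul_ofReal, key]
  linear_combination -hd'
end
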